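/- There exists no finite matchstick graph in which every vertex has degree at least 5. That is, there is no finite simple graph G = (V,E) with minimum degree at least 5, together with an injective map g : V → ℝ² such that every edge of G joins points at Euclidean distance 1 and the closed segments of any two vertex-disjoint edges are disjoint. -/

import Mathlib

/-- A matchstick embedding of a simple graph `G` in the plane: an injective map
`g` of the vertices into `ℝ²` such that every edge joins points at Euclidean
distance `1`, and the closed segments of any two vertex-disjoint edges are
disjoint. -/
def IsMatchstickEmbedding {V : Type*} (G : SimpleGraph V)
    (g : V → EuclideanSpace ℝ (Fin 2)) : Prop :=
  Function.Injective g ∧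
  (∀ i j : V, G.Adj i j → dist (g i) (g j) = 1) ∧
  (∀ i₁ j₁ i₂ j₂ : V, G.Adj i₁ j₁ → G.Adj i₂ j₂ →
    ({i₁, j₁} : Set V) ∩ ({i₂, j₂} : Set V) = ∅ →
    segment ℝ (g i₁) (g j₁) ∩ segment ℝ (g i₂) (g j₂) = ∅)

namespace Match5
open Real

/-- demand of a corner of angle `t`. -/
noncomputable def dem (t : ℝ) : ℝ := max 0 (π / 3 - t)
/-- half of the excess of a corner of angle `t`. -/
noncomputable def off (t : ℝ) : ℝ := max 0 ((t - 2 * π / 3) / 2)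

lemma off_nonneg (t : ℝ) : 0 ≤ off t := le_max_left _ _
lemma off_ge (t : ℝ) : (t - 2 * π / 3) / 2 ≤ off t := le_max_right _ _
lemma dem_nonneg (t : ℝ) : 0 ≤ dem t := le_max_left _ _
lemma dem_small {t : ℝ} (h : t < π / 3) : dem t = π / 3 - t := max_eq_right (by linarith)
lemma dem_large {t : ℝ} (h : ¬ t < π / 3) : dem t = 0 := max_eq_left (by linarith)

/-- what a small corner gets from its immediate neighbour -/
noncomputable def gf1 (x y : ℝ) : ℝ := if x < π / 3 then min (off y) (π / 3) else 0
/-- what a small corner gets at distance two -/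
noncomputable def gf2 (x y : ℝ) : ℝ := if x < π / 3 ∧ π ≤ y then dem x / 2 else 0
/-- what a small corner gets at distance three -/
noncomputable def gf3 (x m y : ℝ) : ℝ :=
  if x < π / 3 ∧ m < π / 3 ∧ 5 * π / 3 < y then dem x / 2 else 0

lemma gf1_nonneg (x y : ℝ) : 0 ≤ gf1 x y := by
  unfold gf1; split_ifs
  · exact le_min (off_nonneg _) (by positivity)
  · exact le_rfl
lemma gf2_nonneg (x y : ℝ) : 0 ≤ gf2 x y := by
  unfold gf2; split_ifs
  · have := dem_nonneg x; positivity
  · exact le_rfl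
lemma gf3_nonneg (x m y : ℝ) : 0 ≤ gf3 x m y := by
  unfold gf3; split_ifs
  · have := dem_nonneg x; positivity
  · exact le_rfl

/-- offers in one direction are bounded. -/
lemma given_le (y a b c : ℝ) (hb : 0 < b) (hc : 0 < c) (hab : a < π / 3 → π / 3 ≤ b) :
    gf1 a y + gf2 b y + gf3 c a y ≤ off y ∧
      (π ≤ y → ¬ a < π / 3 → gf1 a y + gf2 b y + gf3 c a y < off y) := by
  have hpi := Real.pi_pos
  have ho := off_nonneg y
  have ho2 := off_ge y
  by_cases ha : a < π / 3
  · have hb' := hab ha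
    have h2 : gf2 b y = 0 := by unfold gf2; rw [if_neg]; intro h; linarith [h.1]
    have h1 : gf1 a y = min (off y) (π / 3) := by unfold gf1; rw [if_pos ha]
    refine ⟨?_, fun _ h => absurd ha h⟩
    rw [h1, h2]
    unfold gf3
    split_ifs with h
    · rw [dem_small h.1]
      have := min_le_right (off y) (π / 3)
      linarith [h.2.2]
    · have := min_le_left (off y) (π / 3)
      linarith
  · have h1 : gf1 a y = 0 := by unfold gf1; rw [if_neg ha]
    have h3 : gf3 c a y = 0 := by unfold gf3; rw [if_neg]; intro h; exact ha h.2.1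
    rw [h1, h3]
    unfold gf2
    split_ifs with h
    · rw [dem_small h.1]
      constructor
      · linarith [h.2]
      · intro _ _; linarith [h.2]
    · constructor
      · linarith
      · intro hy _; linarith

/-- small corners get enough -/
lemma received_ge (x p1 p2 p3 m1 m2 m3 : ℝ) (hx : 0 < x) (hxs : x < π / 3)
    (h : 2 * π - 2 * x < p1 + m1 ∨ (p1 = π - x ∧ m1 = π - x) ∨
      (π - x < p1 ∧ (π ≤ m2 ∨ (m2 < π / 3 ∧ 5 * π / 3 < m3))) ∨
      (π - x < m1 ∧ (π ≤ p2 ∨ (p2 < π / 3 ∧ 5 * π / 3 < p3)))) :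
    dem x ≤ (gf1 x p1 + gf2 x p2 + gf3 x p2 p3) + (gf1 x m1 + gf2 x m2 + gf3 x m2 m3) ∧
    ((π ≤ p1 ∨ π ≤ m1) →
     dem x < (gf1 x p1 + gf2 x p2 + gf3 x p2 p3) + (gf1 x m1 + gf2 x m2 + gf3 x m2 m3)) := by
  have hpi := Real.pi_pos
  have e1 := gf1_nonneg x p1
  have e2 := gf2_nonneg x p2
  have e3 := gf3_nonneg x p2 p3
  have e4 := gf1_nonneg x m1
  have e5 := gf2_nonneg x m2
  have e6 := gf3_nonneg x m2 m3
  have d := dem_small hxs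
  have key : ∀ y, gf1 x y = π / 3 ∨ (y - 2 * π / 3) / 2 ≤ gf1 x y := by
    intro y
    unfold gf1
    rw [if_pos hxs]
    rcases le_total (off y) (π / 3) with h | h
    · right; rw [min_eq_left h]; exact off_ge y
    · left; exact min_eq_right h
  have g2 : ∀ y, π ≤ y → gf2 x y = (π / 3 - x) / 2 := by
    intro y hy; unfold gf2; rw [if_pos ⟨hxs, hy⟩, d]
  have g3 : ∀ m y, m < π / 3 → 5 * π / 3 < y → gf3 x m y = (π / 3 - x) / 2 := by
    intro m y hm hy; unfold gf3; rw [if_pos ⟨hxs, hm, hy⟩, d]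
  rw [d]
  rcases key p1 with k1 | k1
  · constructor
    · linarith
    · intro _; linarith
  rcases key m1 with k2 | k2
  · constructor
    · linarith
    · intro _; linarith
  rcases h with h | ⟨h, h'⟩ | ⟨h, h' | ⟨h', h''⟩⟩ | ⟨h, h' | ⟨h', h''⟩⟩
  · constructor
    · linarith
    · intro _; linarith
  · constructor
    · linarith
    · rintro (h | h) <;> linarith
  · have := g2 _ h'
    constructor
    · linarith
    · rintro (h | h) <;> linarith
  · have := g3 _ _ h' h''
    constructor
    · linarith
    · rintro (h | h) <;> linarith
  · have := g2 _ h'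
    constructor
    · linarith
    · rintro (h | h) <;> linarith
  · have := g3 _ _ h' h''
    constructor
    · linarith
    · rintro (h | h) <;> linarith

/-- the discharging argument along the face permutation -/
lemma discharge {X : Type*} [Fintype X] (φ : Equiv.Perm X) (α : X → ℝ)
    (hα : ∀ x, 0 < α x)
    (hadj : ∀ x, α x < π / 3 → π / 3 ≤ α (φ x) ∧ π / 3 ≤ α (φ.symm x))
    (hmain : ∀ x, α x < π / 3 →
      2 * π - 2 * α x < α (φ x) + α (φ.symm x) ∨
      (α (φ x) = π - α x ∧ α (φ.symm x) = π - α x) ∨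
      (π - α x < α (φ x) ∧ (π ≤ α (φ.symm (φ.symm x)) ∨ (α (φ.symm (φ.symm x)) < π / 3 ∧
        5 * π / 3 < α (φ.symm (φ.symm (φ.symm x)))))) ∨
      (π - α x < α (φ.symm x) ∧ (π ≤ α (φ (φ x)) ∨ (α (φ (φ x)) < π / 3 ∧
        5 * π / 3 < α (φ (φ (φ x)))))))
    (x₀ : X) (hx₀ : π ≤ α x₀) :
    ∑ x, (dem (α x) - 2 * off (α x)) < 0 := by
  set R : X → ℝ := fun x =>
    (gf1 (α x) (α (φ x)) + gf2 (α x) (α (φ (φ x))) + gf3 (α x) (α (φ (φ x))) (α (φ (φ (φ x)))))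
    + (gf1 (α x) (α (φ.symm x)) + gf2 (α x) (α (φ.symm (φ.symm x)))
      + gf3 (α x) (α (φ.symm (φ.symm x))) (α (φ.symm (φ.symm (φ.symm x))))) with hR
  set S : X → ℝ := fun y =>
    (gf1 (α (φ.symm y)) (α y) + gf2 (α (φ.symm (φ.symm y))) (α y)
      + gf3 (α (φ.symm (φ.symm (φ.symm y)))) (α (φ.symm y)) (α y))
    + (gf1 (α (φ y)) (α y) + gf2 (α (φ (φ y))) (α y)
      + gf3 (α (φ (φ (φ y)))) (α (φ y)) (α y)) with hS
  have hsum : ∑ x, R x = ∑ x, S x := by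
    simp only [hR, hS, Finset.sum_add_distrib]
    have a1 := Equiv.sum_comp φ (fun y => gf1 (α (φ.symm y)) (α y))
    have a2 := Equiv.sum_comp (φ.trans φ) (fun y => gf2 (α (φ.symm (φ.symm y))) (α y))
    have a3 := Equiv.sum_comp ((φ.trans φ).trans φ)
      (fun y => gf3 (α (φ.symm (φ.symm (φ.symm y)))) (α (φ.symm y)) (α y))
    have b1 := Equiv.sum_comp φ.symm (fun y => gf1 (α (φ y)) (α y))
    have b2 := Equiv.sum_comp (φ.symm.trans φ.symm) (fun y => gf2 (α (φ (φ y))) (α y))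
    have b3 := Equiv.sum_comp ((φ.symm.trans φ.symm).trans φ.symm)
      (fun y => gf3 (α (φ (φ (φ y)))) (α (φ y)) (α y))
    simp only [Equiv.trans_apply, Equiv.symm_apply_apply, Equiv.apply_symm_apply] at a1 a2 a3 b1 b2 b3
    rw [a1, a2, a3, b1, b2, b3]
  have hA : ∀ x, dem (α x) ≤ R x := by
    intro x
    by_cases hx : α x < π / 3
    · exact (received_ge _ _ _ _ _ _ _ (hα x) hx (hmain x hx)).1
    · rw [dem_large hx]
      have := gf1_nonneg (α x) (α (φ x))
      have := gf2_nonneg (α x) (α (φ (φ x)))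
      have := gf3_nonneg (α x) (α (φ (φ x))) (α (φ (φ (φ x))))
      have := gf1_nonneg (α x) (α (φ.symm x))
      have := gf2_nonneg (α x) (α (φ.symm (φ.symm x)))
      have := gf3_nonneg (α x) (α (φ.symm (φ.symm x))) (α (φ.symm (φ.symm (φ.symm x))))
      simp only [hR]
      linarith
  have hG1 := fun y => given_le (α y) (α (φ.symm y)) (α (φ.symm (φ.symm y)))
    (α (φ.symm (φ.symm (φ.symm y)))) (hα _) (hα _) (fun h => (hadj _ h).2)
  have hG2 := fun y => given_le (α y) (α (φ y)) (α (φ (φ y)))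
    (α (φ (φ (φ y)))) (hα _) (hα _) (fun h => (hadj _ h).1)
  have hB : ∀ y, S y ≤ 2 * off (α y) := by
    intro y
    have := (hG1 y).1
    have := (hG2 y).1
    simp only [hS]
    linarith
  rw [Finset.sum_sub_distrib]
  by_cases h1 : α (φ.symm x₀) < π / 3
  · have : ∑ x, dem (α x) < ∑ x, R x := by
      refine Finset.sum_lt_sum (fun x _ => hA x) ⟨φ.symm x₀, Finset.mem_univ _, ?_⟩
      refine (received_ge _ _ _ _ _ _ _ (hα _) h1 (hmain _ h1)).2 (Or.inl ?_)
      simpa using hx₀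
    have : ∑ x, S x ≤ ∑ x, 2 * off (α x) := Finset.sum_le_sum (fun x _ => hB x)
    linarith
  by_cases h2 : α (φ x₀) < π / 3
  · have : ∑ x, dem (α x) < ∑ x, R x := by
      refine Finset.sum_lt_sum (fun x _ => hA x) ⟨φ x₀, Finset.mem_univ _, ?_⟩
      refine (received_ge _ _ _ _ _ _ _ (hα _) h2 (hmain _ h2)).2 (Or.inr ?_)
      simpa using hx₀
    have : ∑ x, S x ≤ ∑ x, 2 * off (α x) := Finset.sum_le_sum (fun x _ => hB x)
    linarith
  · have : ∑ x, dem (α x) ≤ ∑ x, R x := Finset.sum_le_sum (fun x _ => hA x)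
    have : ∑ x, S x < ∑ x, 2 * off (α x) := by
      refine Finset.sum_lt_sum (fun x _ => hB x) ⟨x₀, Finset.mem_univ _, ?_⟩
      have := (hG1 x₀).2 hx₀ h1
      have := (hG2 x₀).2 hx₀ h2
      simp only [hS]
      linarith
    linarith

/-- the vertex inequality -/
lemma vertex_ineq {X : Type*} (s : Finset X) (α : X → ℝ) (hcard : 5 ≤ s.card)
    (hsum : ∑ x ∈ s, α x ≤ 2 * π) : 0 ≤ ∑ x ∈ s, (dem (α x) - 2 * off (α x)) := by
  have hpi := Real.pi_pos
  by_cases h : ∀ x ∈ s, α x ≤ 2 * π / 3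
  · refine Finset.sum_nonneg fun x hx => ?_
    have : off (α x) = 0 := max_eq_left (by linarith [h x hx])
    rw [this]
    linarith [dem_nonneg (α x)]
  · push Not at h
    obtain ⟨y, hy, hy'⟩ := h
    classical
    have hpt : ∀ x ∈ s, (π / 3 - α x) + (if x = y then π / 3 else 0)
        ≤ dem (α x) - 2 * off (α x) := by
      intro x hx
      have h1 := dem_nonneg (α x)
      have h2 : π / 3 - α x ≤ dem (α x) := le_max_right _ _
      split_ifs with hxy
      · subst hxy
        have : off (α x) = (α x - 2 * π / 3) / 2 := max_eq_right (by linarith)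
        rw [this]; linarith
      · unfold off
        rcases le_total 0 ((α x - 2 * π / 3) / 2) with h3 | h3
        · rw [max_eq_right h3]; linarith
        · rw [max_eq_left h3]; linarith
    have := Finset.sum_le_sum hpt
    rw [Finset.sum_add_distrib, Finset.sum_sub_distrib, Finset.sum_ite_eq' s y, if_pos hy,
      Finset.sum_const, nsmul_eq_mul] at this
    have hc : (5 : ℝ) ≤ s.card := by exact_mod_cast hcard
    have : (5 : ℝ) * (π / 3) ≤ s.card * (π / 3) := mul_le_mul_of_nonneg_right hc (by positivity)
    linarith

end Match5

namespace Match5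
open Real

/-- A unit distance, non crossing relation on the plane. -/
def Mt (E : ℂ → ℂ → Prop) : Prop :=
  (∀ p q, E p q → E q p) ∧ (∀ p q, E p q → ‖p - q‖ = 1) ∧
  (∀ p q r s, E p q → E r s → p ≠ r → p ≠ s → q ≠ r → q ≠ s →
    ∀ z, z ∈ segment ℝ p q → z ∈ segment ℝ r s → False)

lemma mem_seg {p q z : ℂ} {t : ℝ} (h0 : 0 ≤ t) (h1 : t ≤ 1) (hz : z = p + t * (q - p)) :
    z ∈ segment ℝ p q := by
  refine ⟨1 - t, t, by linarith, h0, by ring, ?_⟩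
  rw [hz, Complex.real_smul, Complex.real_smul]
  push_cast
  ring

lemma Mt.cross {E : ℂ → ℂ → Prop} (hE : Mt E) {p q r s : ℂ} (h1 : E p q) (h2 : E r s)
    (a1 : p ≠ r) (a2 : p ≠ s) (a3 : q ≠ r) (a4 : q ≠ s) {t u : ℝ} (ht0 : 0 ≤ t) (ht1 : t ≤ 1)
    (hu0 : 0 ≤ u) (hu1 : u ≤ 1) (h : p + t * (q - p) = r + u * (s - r)) : False :=
  hE.2.2 p q r s h1 h2 a1 a2 a3 a4 _ (mem_seg ht0 ht1 rfl) (mem_seg hu0 hu1 h)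

/-- exit time of a coordinate -/
noncomputable def exitT (l m : ℝ) : ℝ := if m < 0 then l / (l - m) else 1

lemma exitT_nonneg {l m : ℝ} (hl : 0 ≤ l) : 0 ≤ exitT l m := by
  unfold exitT; split_ifs with h
  · exact div_nonneg hl (by linarith)
  · exact zero_le_one

lemma exitT_le {l m : ℝ} (hl : 0 ≤ l) : exitT l m ≤ 1 := by
  unfold exitT; split_ifs with h
  · rw [div_le_one (by linarith)]; linarith
  · exact le_rfl

lemma exitT_lt {l m : ℝ} (hl : 0 ≤ l) (hm : m < 0) : exitT l m < 1 := by
  unfold exitT; rw [if_pos hm, div_lt_one (by linarith)]; linarith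

lemma exitT_eq {l m : ℝ} (hl : 0 ≤ l) (hm : m < 0) : l + exitT l m * (m - l) = 0 := by
  unfold exitT; rw [if_pos hm]
  have : l - m ≠ 0 := by linarith
  field_simp
  ring

lemma exitT_ge {l m t : ℝ} (hl : 0 ≤ l) (ht0 : 0 ≤ t) (ht : t ≤ exitT l m) :
    0 ≤ l + t * (m - l) := by
  by_cases hm : m < 0
  · have h := exitT_eq hl hm
    nlinarith
  · have h := exitT_le (m := m) hl
    nlinarith

/-- first exit from a triangle in barycentric coordinates -/
lemma pasch (l1 l2 l3 m1 m2 m3 : ℝ) (h1 : 0 ≤ l1) (h2 : 0 ≤ l2) (h3 : 0 ≤ l3) :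
    (0 ≤ m1 ∧ 0 ≤ m2 ∧ 0 ≤ m3) ∨ ∃ t : ℝ, 0 ≤ t ∧ t ≤ 1 ∧
      0 ≤ l1 + t * (m1 - l1) ∧ 0 ≤ l2 + t * (m2 - l2) ∧ 0 ≤ l3 + t * (m3 - l3) ∧
      ((m1 < 0 ∧ l1 + t * (m1 - l1) = 0) ∨ (m2 < 0 ∧ l2 + t * (m2 - l2) = 0) ∨
        (m3 < 0 ∧ l3 + t * (m3 - l3) = 0)) := by
  by_cases hall : 0 ≤ m1 ∧ 0 ≤ m2 ∧ 0 ≤ m3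
  · exact Or.inl hall
  right
  set t := min (exitT l1 m1) (min (exitT l2 m2) (exitT l3 m3)) with ht
  have t1 : t ≤ exitT l1 m1 := min_le_left _ _
  have t2 : t ≤ exitT l2 m2 := (min_le_right _ _).trans (min_le_left _ _)
  have t3 : t ≤ exitT l3 m3 := (min_le_right _ _).trans (min_le_right _ _)
  have t0 : 0 ≤ t := le_min (exitT_nonneg h1) (le_min (exitT_nonneg h2) (exitT_nonneg h3))
  have tlt : t < 1 := by
    by_contra hcon
    push Not at hcon
    apply hall
    refine ⟨?_, ?_, ?_⟩ <;> by_contra hm <;> push Not at hm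
    · linarith [exitT_lt h1 hm]
    · linarith [exitT_lt h2 hm]
    · linarith [exitT_lt h3 hm]
  have hcase : t = exitT l1 m1 ∨ t = exitT l2 m2 ∨ t = exitT l3 m3 := by
    rcases min_choice (exitT l1 m1) (min (exitT l2 m2) (exitT l3 m3)) with h | h
    · exact Or.inl (ht.trans h)
    · rcases min_choice (exitT l2 m2) (exitT l3 m3) with h' | h'
      · exact Or.inr (Or.inl (ht.trans (h.trans h')))
      · exact Or.inr (Or.inr (ht.trans (h.trans h')))
  have neg : ∀ l m, t = exitT l m → m < 0 := by
    intro l m h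
    by_contra hm
    unfold exitT at h
    rw [if_neg hm] at h
    linarith
  refine ⟨t, t0, tlt.le, exitT_ge h1 t0 t1, exitT_ge h2 t0 t2, exitT_ge h3 t0 t3, ?_⟩
  rcases hcase with h | h | h
  · left; exact ⟨neg _ _ h, by rw [h]; exact exitT_eq h1 (neg _ _ h)⟩
  · right; left; exact ⟨neg _ _ h, by rw [h]; exact exitT_eq h2 (neg _ _ h)⟩
  · right; right; exact ⟨neg _ _ h, by rw [h]; exact exitT_eq h3 (neg _ _ h)⟩

lemma norm_comb {x y w c : ℂ} {l m n : ℝ} (hl : 0 ≤ l) (hm : 0 ≤ m) (hn : 0 ≤ n)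
    (hs : l + m + n = 1) :
    ‖(l * x + m * y + n * w) - c‖ ≤ l * ‖x - c‖ + m * ‖y - c‖ + n * ‖w - c‖ := by
  have hs' : (l : ℂ) + m + n = 1 := by exact_mod_cast hs
  have e : (l * x + m * y + n * w) - c = l * (x - c) + m * (y - c) + n * (w - c) := by
    linear_combination c * hs'
  rw [e]
  have k : ∀ (t : ℝ) (z : ℂ), 0 ≤ t → ‖(t : ℂ) * z‖ = t * ‖z‖ := by
    intro t z ht
    rw [norm_mul, Complex.norm_real, Real.norm_of_nonneg ht]
  calc _ ≤ ‖(l : ℂ) * (x - c)‖ + ‖(m : ℂ) * (y - c)‖ + ‖(n : ℂ) * (w - c)‖ := norm_add₃_le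
    _ = _ := by rw [k _ _ hl, k _ _ hm, k _ _ hn]

/-- The pocket configuration. -/
structure Pocket (E : ℂ → ℂ → Prop) (b p a1 b1 : ℂ) (κ r pX pY : ℝ) : Prop where
  mt : Mt E
  e0 : E 0 1
  eb : E 0 b
  ea1 : E 1 a1
  ebb1 : E b b1
  nb : ‖1 - b‖ < 1
  coord : ∀ z : ℂ, ∃ X Y : ℝ, z = X + Y * b
  hp : p = pX + pY * b
  hsum : 1 < pX + pY
  ha1 : a1 = 1 + κ * (p - 1)
  κ0 : 0 < κ
  κ1 : κ < 1
  hpb : p = b + r * (b1 - b)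
  r0 : 0 < r
  r1 : r < 1
  na1p : ‖p - a1‖ < 1
  na1 : ‖a1‖ ≠ 1

variable {E : ℂ → ℂ → Prop} {b p a1 b1 : ℂ} {κ r pX pY : ℝ}

lemma Pocket.nb1 (P : Pocket E b p a1 b1 κ r pX pY) : ‖b - b1‖ = 1 := P.mt.2.1 _ _ P.ebb1

lemma Pocket.nbb (P : Pocket E b p a1 b1 κ r pX pY) : ‖b‖ = 1 := by
  simpa using P.mt.2.1 _ _ P.eb

lemma Pocket.npb (P : Pocket E b p a1 b1 κ r pX pY) : ‖p - b‖ < 1 := by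
  have : p - b = r * (b1 - b) := by rw [P.hpb]; ring
  rw [this, norm_mul, Complex.norm_real, Real.norm_of_nonneg P.r0.le, norm_sub_rev, P.nb1]
  linarith [P.r1]

lemma Pocket.na1b (P : Pocket E b p a1 b1 κ r pX pY) : ‖a1 - b‖ < 1 := by
  have e : a1 = ((1 - κ : ℝ) : ℂ) * 1 + (κ : ℝ) * p + ((0 : ℝ) : ℂ) * 0 := by
    rw [P.ha1]; push_cast; ring
  have := norm_comb (x := 1) (y := p) (w := 0) (c := b) (l := 1 - κ) (m := κ) (n := 0)
    (by linarith [P.κ1]) P.κ0.le le_rfl (by ring)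
  rw [← e] at this
  nlinarith [P.nb, P.npb, P.κ0, P.κ1]

lemma Pocket.b1ne (P : Pocket E b p a1 b1 κ r pX pY) :
    b1 = ((0 : ℝ) : ℂ) + ((1 - 1 / r : ℝ) : ℂ) * b + ((1 / r : ℝ) : ℂ) * p := by
  rw [P.hpb]
  have : (r : ℂ) ≠ 0 := by exact_mod_cast P.r0.ne'
  push_cast
  field_simp
  ring

/-- coordinates with respect to the upper triangle -/
lemma Pocket.coord2 (P : Pocket E b p a1 b1 κ r pX pY) (z : ℂ) {X Y : ℝ} (hz : z = X + Y * b) :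
    ∃ ma mb mp : ℝ, ma + mb + mp = 1 ∧ z = ma + mb * b + mp * p ∧
      X + Y - 1 = mp * (pX + pY - 1) := by
  have h : pX + pY - 1 ≠ 0 := by linarith [P.hsum]
  refine ⟨X - (X + Y - 1) / (pX + pY - 1) * pX, Y - (X + Y - 1) / (pX + pY - 1) * pY,
    (X + Y - 1) / (pX + pY - 1), ?_, ?_, ?_⟩
  · field_simp; ring
  · rw [hz, P.hp]; push_cast; ring
  · field_simp

lemma uniq_b1 (P : Pocket E b p a1 b1 κ r pX pY) {ma mb mp : ℝ} (hs : ma + mb + mp = 1)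
    (h : b1 = ma + mb * b + mp * p)
    (hind : ∀ X Y : ℝ, (X : ℂ) + Y * b = 0 → X = 0 ∧ Y = 0) :
    ma = 0 ∧ mb < 0 := by
  have e := P.b1ne
  rw [h] at e
  have hs' : (ma : ℂ) = 1 - mb - mp := by
    have : ma = 1 - mb - mp := by linarith
    rw [this]; push_cast; ring
  rw [P.hp] at e
  have := hind (ma + (mp - 1 / r) * pX) (mb - (1 - 1 / r) + (mp - 1 / r) * pY) (by
    push_cast at e ⊢
    linear_combination e)
  have h1 : (mp - 1 / r) * (pX + pY - 1) = 0 := by linarith [this.1, this.2]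
  have h2 : mp - 1 / r = 0 := by
    rcases mul_eq_zero.1 h1 with h | h
    · exact h
    · linarith [P.hsum]
  rw [h2] at this
  have h3 : 1 < 1 / r := by rw [lt_div_iff₀ P.r0]; linarith [P.r1]
  constructor
  · linarith [this.1]
  · linarith [this.2]

lemma trap1 (P : Pocket E b p a1 b1 κ r pX pY)
    (hind : ∀ X Y : ℝ, (X : ℂ) + Y * b = 0 → X = 0 ∧ Y = 0)
    {a2 : ℂ} (h2 : E a1 a2)
    (hside : ∀ ma mb mp : ℝ, ma + mb + mp = 1 → a2 = ma + mb * b + mp * p → 0 < mb) :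
    ∃ X Y : ℝ, 0 ≤ X ∧ 0 ≤ Y ∧ X + Y < 1 ∧ a2 = X + Y * b ∧ ‖a2 - 1‖ < 1 ∧ ‖a2 - b‖ < 1 ∧
      a2 ≠ 0 := by
  have n12 : ‖a1 - a2‖ = 1 := P.mt.2.1 _ _ h2
  have n11 : ‖(1 : ℂ) - a1‖ = 1 := P.mt.2.1 _ _ P.ea1
  obtain ⟨X, Y, hXY⟩ := P.coord a2
  obtain ⟨ma, mb, mp, hs, hm, hrel⟩ := P.coord2 a2 hXY
  have hmb := hside _ _ _ hs hm
  have a2b : a2 ≠ b := by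
    rintro rfl; linarith [P.na1b]
  have a1b : a1 ≠ b := by
    intro h; rw [h] at n11; linarith [P.nb]
  have a1b1 : a1 ≠ b1 := by
    intro h; have := P.na1b; rw [h, norm_sub_rev, P.nb1] at this; linarith
  have a2b1 : a2 ≠ b1 := by
    intro h
    rw [h] at hm
    linarith [(uniq_b1 P hs hm hind).2]
  have a10 : a1 ≠ 0 := by
    intro h; rw [h] at h2
    have := P.na1b
    rw [h, zero_sub, norm_neg, P.nbb] at this; linarith
  have a20 : a2 ≠ 0 := by
    intro h; rw [h, sub_zero] at n12; exact P.na1 n12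
  have a21 : a2 ≠ 1 := by
    intro h
    have := hind (ma + mp * pX - 1) (mb + mp * pY) (by
      rw [h, P.hp] at hm; push_cast; linear_combination -hm)
    have h1 : mp * (pX + pY - 1) = 0 := by linarith [this.1, this.2]
    rcases mul_eq_zero.1 h1 with h | h
    · rw [h] at this; linarith [this.2]
    · linarith [P.hsum]
  have a11 : a1 ≠ 1 := by
    intro h; rw [h] at n11; simp at n11
  -- first exit
  have hq : ∃ t q1 q2 : ℝ, 0 ≤ t ∧ t ≤ 1 ∧ 0 ≤ q1 ∧ 0 ≤ q2 ∧ q1 + q2 = 1 ∧ mp < 0 ∧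
      a1 + t * (a2 - a1) = q1 + q2 * b := by
    rcases pasch (1 - κ) 0 κ ma mb mp (by linarith [P.κ1]) le_rfl P.κ0.le with h | h
    · exfalso
      obtain ⟨g1, g2, g3⟩ := h
      have := norm_comb (x := 1) (y := b) (w := p) (c := a1) g1 g2 g3 hs
      rw [mul_one, ← hm, norm_sub_rev a2 a1, n12, n11] at this
      have k1 := P.na1b
      rw [norm_sub_rev] at k1
      have k2 := P.na1p
      nlinarith
    · obtain ⟨t, t0, t1, g1, g2, g3, h⟩ := h
      rcases h with ⟨hn, h⟩ | ⟨hn, h⟩ | ⟨hn, h⟩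
      · exfalso
        have hsum2 : (0 + t * (mb - 0)) + (κ + t * (mp - κ)) = 1 := by
          linear_combination t * hs - h
        refine P.mt.cross h2 P.ebb1 a1b a1b1 a2b a2b1 t0 t1
          (u := (κ + t * (mp - κ)) * r) (mul_nonneg g3 P.r0.le) (by nlinarith [P.r0, P.r1]) ?_
        have hC : (1 - κ + t * (ma - (1 - κ)) : ℂ) = 0 := by exact_mod_cast h
        have hC2 : ((0 + t * (mb - 0)) + (κ + t * (mp - κ)) : ℂ) = 1 := by exact_mod_cast hsum2
        have hpb := P.hpb
        rw [hm, P.ha1]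
        push_cast
        linear_combination hC + b * hC2 + (κ + t * (mp - κ)) * hpb
      · linarith
      · refine ⟨t, 1 - κ + t * (ma - (1 - κ)), 0 + t * (mb - 0), t0, t1, g1, g2, ?_, hn, ?_⟩
        · linear_combination t * hs - h
        · have hC : (κ + t * (mp - κ) : ℂ) = 0 := by exact_mod_cast h
          rw [hm, P.ha1]
          push_cast
          linear_combination p * hC
  obtain ⟨t, q1, q2, t0, t1, hq1, hq2, hqs, hmp, hq⟩ := hq
  have hX1 : X + Y < 1 := by nlinarith [P.hsum]
  have hq1' : (q1 : ℂ) = 1 - q2 := by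
    have : q1 = 1 - q2 := by linarith
    rw [this]; push_cast; ring
  -- the parameter on the long segment
  have hpt : ∀ u : ℝ, 0 ≤ u → u ≤ 1 → 0 ≤ t + u * (1 - t) ∧ t + u * (1 - t) ≤ 1 := by
    intro u u0 u1
    constructor <;> nlinarith
  have hpos : 0 ≤ X ∧ 0 ≤ Y := by
    rcases pasch (1 - q1 - q2) q1 q2 (1 - X - Y) X Y (by linarith) hq1 hq2 with h | h
    · exact h.2
    · exfalso
      obtain ⟨u, u0, u1, g1, g2, g3, h⟩ := h
      have hsm : (1 - q1 - q2 + u * (1 - X - Y - (1 - q1 - q2))) + (q1 + u * (X - q1)) +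
        (q2 + u * (Y - q2)) = 1 := by ring
      have he : a1 + ((t + u * (1 - t) : ℝ) : ℂ) * (a2 - a1) =
          ((q1 + u * (X - q1) : ℝ) : ℂ) + ((q2 + u * (Y - q2) : ℝ) : ℂ) * b := by
        push_cast
        linear_combination (1 - u) * hq + u * hXY
      rcases h with ⟨hn, h⟩ | ⟨hn, h⟩ | ⟨hn, h⟩
      · linarith
      · refine P.mt.cross h2 P.eb a10 a1b a20 a2b (hpt u u0 u1).1 (hpt u u0 u1).2
          (u := q2 + u * (Y - q2)) g3 (by linarith) ?_
        rw [he, h]; push_cast; ring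
      · refine P.mt.cross h2 P.e0 a10 a11 a20 a21 (hpt u u0 u1).1 (hpt u u0 u1).2
          (u := q1 + u * (X - q1)) g2 (by linarith) ?_
        rw [he, h]; push_cast; ring
  have hnz : 0 < X ∨ 0 < Y := by
    by_contra hcon
    push Not at hcon
    apply a20
    rw [hXY, le_antisymm hcon.1 hpos.1, le_antisymm hcon.2 hpos.2]; simp
  refine ⟨X, Y, hpos.1, hpos.2, hX1, hXY, ?_, ?_, a20⟩
  · have := norm_comb (x := 0) (y := 1) (w := b) (c := 1) (l := 1 - X - Y) (m := X) (n := Y)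
      (by linarith) hpos.1 hpos.2 (by ring)
    have e : ((1 - X - Y : ℝ) : ℂ) * 0 + (X : ℂ) * 1 + Y * b = a2 := by rw [hXY]; ring
    rw [e, zero_sub, norm_neg, norm_one, sub_self, norm_zero, norm_sub_rev b 1] at this
    rcases hnz with h | h
    · nlinarith [P.nb, hpos.1, hpos.2]
    · nlinarith [P.nb, hpos.1, hpos.2]
  · have := norm_comb (x := 0) (y := 1) (w := b) (c := b) (l := 1 - X - Y) (m := X) (n := Y)
      (by linarith) hpos.1 hpos.2 (by ring)
    have e : ((1 - X - Y : ℝ) : ℂ) * 0 + (X : ℂ) * 1 + Y * b = a2 := by rw [hXY]; ring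
    rw [e, zero_sub, norm_neg, P.nbb, sub_self, norm_zero] at this
    rcases hnz with h | h
    · nlinarith [P.nb, hpos.1, hpos.2]
    · nlinarith [P.nb, hpos.1, hpos.2]

lemma trap2 (P : Pocket E b p a1 b1 κ r pX pY)
    (hind : ∀ X Y : ℝ, (X : ℂ) + Y * b = 0 → X = 0 ∧ Y = 0)
    {a2 d : ℂ} {X Y : ℝ} (hX : 0 ≤ X) (hY : 0 ≤ Y) (hXY1 : X + Y < 1) (hXY : a2 = X + Y * b)
    (n21 : ‖a2 - 1‖ < 1) (n2b : ‖a2 - b‖ < 1) (a20 : a2 ≠ 0) (h3 : E a2 d) (h2 : E a1 a2)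
    (hd : d ≠ a1) :
    ‖d - a1‖ < 1 ∨ ∃ t τ : ℝ, 0 ≤ t ∧ t ≤ 1 ∧ κ < τ ∧ a2 + t * (d - a2) = 1 + τ * (p - 1) := by
  have n23 : ‖a2 - d‖ = 1 := P.mt.2.1 _ _ h3
  have n12 : ‖a1 - a2‖ = 1 := P.mt.2.1 _ _ h2
  have n11 : ‖(1 : ℂ) - a1‖ = 1 := P.mt.2.1 _ _ P.ea1
  obtain ⟨X', Y', hXY'⟩ := P.coord d
  obtain ⟨ma, mb, mp, hs, hm, hrel⟩ := P.coord2 d hXY'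
  have n20 : ‖a2‖ < 1 := by
    have := norm_comb (x := 0) (y := 1) (w := b) (c := 0) (l := 1 - X - Y) (m := X) (n := Y)
      (by linarith) hX hY (by ring)
    have e : ((1 - X - Y : ℝ) : ℂ) * 0 + (X : ℂ) * 1 + Y * b = a2 := by rw [hXY]; ring
    rw [e] at this
    simp only [sub_zero, norm_zero, norm_one, P.nbb] at this
    linarith
  have d0 : d ≠ 0 := by
    intro h; rw [h, sub_zero] at n23; linarith
  have d1 : d ≠ 1 := by
    intro h; rw [h] at n23; linarith
  have db : d ≠ b := by
    intro h; rw [h] at n23; linarith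
  have a21 : a2 ≠ 1 := by
    intro h
    have := hind (X - 1) Y (by rw [h] at hXY; push_cast; linear_combination -hXY)
    linarith [this.1]
  have a2b : a2 ≠ b := by
    intro h
    have := hind X (Y - 1) (by rw [h] at hXY; push_cast; linear_combination -hXY)
    linarith [this.2]
  have a2b1 : a2 ≠ b1 := by
    intro h
    rw [h, norm_sub_rev, P.nb1] at n2b; linarith
  have a2a1 : a2 ≠ a1 := by
    intro h; rw [h] at n12; simp at n12
  have hq : ∃ t q1 q2 : ℝ, 0 ≤ t ∧ t ≤ 1 ∧ 0 ≤ q1 ∧ 0 ≤ q2 ∧ q1 + q2 = 1 ∧ 1 < X' + Y' ∧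
      a2 + t * (d - a2) = q1 + q2 * b := by
    rcases pasch (1 - X - Y) X Y (1 - X' - Y') X' Y' (by linarith) hX hY with h | h
    · exfalso
      obtain ⟨g1, g2, g3⟩ := h
      have := norm_comb (x := 0) (y := 1) (w := b) (c := a2) g1 g2 g3 (by ring)
      have e : ((1 - X' - Y' : ℝ) : ℂ) * 0 + (X' : ℂ) * 1 + Y' * b = d := by rw [hXY']; ring
      rw [e, norm_sub_rev d a2, n23, zero_sub, norm_neg, norm_sub_rev 1 a2,
        norm_sub_rev b a2] at this
      have hM : max ‖a2‖ (max ‖a2 - 1‖ ‖a2 - b‖) < 1 := max_lt n20 (max_lt n21 n2b)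
      have k1 := le_max_left ‖a2‖ (max ‖a2 - 1‖ ‖a2 - b‖)
      have k2 := (le_max_left ‖a2 - 1‖ ‖a2 - b‖).trans
        (le_max_right ‖a2‖ (max ‖a2 - 1‖ ‖a2 - b‖))
      have k3 := (le_max_right ‖a2 - 1‖ ‖a2 - b‖).trans
        (le_max_right ‖a2‖ (max ‖a2 - 1‖ ‖a2 - b‖))
      generalize max ‖a2‖ (max ‖a2 - 1‖ ‖a2 - b‖) = M at hM k1 k2 k3
      have := mul_le_mul_of_nonneg_left k1 g1
      have := mul_le_mul_of_nonneg_left k2 g2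
      have := mul_le_mul_of_nonneg_left k3 g3
      linarith
    · obtain ⟨t, t0, t1, g1, g2, g3, h⟩ := h
      have he : a2 + (t : ℂ) * (d - a2) =
          ((X + t * (X' - X) : ℝ) : ℂ) + ((Y + t * (Y' - Y) : ℝ) : ℂ) * b := by
        rw [hXY, hXY']; push_cast; ring
      rcases h with ⟨hn, h⟩ | ⟨hn, h⟩ | ⟨hn, h⟩
      · exact ⟨t, X + t * (X' - X), Y + t * (Y' - Y), t0, t1, g2, g3, by linarith,
          by linarith, he⟩
      · exfalso
        refine P.mt.cross h3 P.eb a20 a2b d0 db t0 t1 (u := Y + t * (Y' - Y)) g3 (by linarith) ?_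
        rw [he, h]; push_cast; ring
      · exfalso
        refine P.mt.cross h3 P.e0 a20 a21 d0 d1 t0 t1 (u := X + t * (X' - X)) g2 (by linarith) ?_
        rw [he, h]; push_cast; ring
  obtain ⟨t, q1, q2, t0, t1, hq1, hq2, hqs, hX1, hq⟩ := hq
  have hmp : 0 < mp := by
    by_contra hcon
    push Not at hcon
    nlinarith [P.hsum]
  have hpt : ∀ u : ℝ, 0 ≤ u → u ≤ 1 → 0 ≤ t + u * (1 - t) ∧ t + u * (1 - t) ≤ 1 := by
    intro u u0 u1
    constructor <;> nlinarith
  rcases pasch q1 q2 0 ma mb mp hq1 hq2 le_rfl with h | h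
  · left
    obtain ⟨g1, g2, g3⟩ := h
    have := norm_comb (x := 1) (y := b) (w := p) (c := a1) g1 g2 g3 hs
    rw [mul_one, ← hm, n11] at this
    have k1 := P.na1b
    rw [norm_sub_rev] at k1
    have k2 := P.na1p
    nlinarith
  · obtain ⟨u, u0, u1, g1, g2, g3, h⟩ := h
    have hsm : (q1 + u * (ma - q1)) + (q2 + u * (mb - q2)) + (0 + u * (mp - 0)) = 1 := by
      linear_combination (1 - u) * hqs + u * hs
    have he : a2 + ((t + u * (1 - t) : ℝ) : ℂ) * (d - a2) =
        ((q1 + u * (ma - q1) : ℝ) : ℂ) + ((q2 + u * (mb - q2) : ℝ) : ℂ) * b +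
        ((0 + u * (mp - 0) : ℝ) : ℂ) * p := by
      push_cast
      linear_combination (1 - u) * hq + u * hm
    rcases h with ⟨hn, h⟩ | ⟨hn, h⟩ | ⟨hn, h⟩
    · exfalso
      have db1 : d ≠ b1 := by
        intro hh; rw [hh] at hm
        linarith [(uniq_b1 P hs hm hind).1]
      refine P.mt.cross h3 P.ebb1 a2b a2b1 db db1 (hpt u u0 u1).1 (hpt u u0 u1).2
          (u := (0 + u * (mp - 0)) * r) (mul_nonneg g3 P.r0.le) (by nlinarith [P.r0, P.r1]) ?_
      have hC2 : (((q2 + u * (mb - q2) : ℝ) : ℂ) + ((0 + u * (mp - 0) : ℝ) : ℂ)) = 1 := by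
        have : (q2 + u * (mb - q2)) + (0 + u * (mp - 0)) = 1 := by linarith
        exact_mod_cast this
      rw [he, h]
      have hpb := P.hpb
      push_cast at hC2 ⊢
      linear_combination b * hC2 + (u * mp) * hpb
    · have he2 : a2 + ((t + u * (1 - t) : ℝ) : ℂ) * (d - a2) =
          1 + ((0 + u * (mp - 0) : ℝ) : ℂ) * (p - 1) := by
        have hC2 : (((q1 + u * (ma - q1) : ℝ) : ℂ) + ((0 + u * (mp - 0) : ℝ) : ℂ)) = 1 := by
          have : (q1 + u * (ma - q1)) + (0 + u * (mp - 0)) = 1 := by linarith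
          exact_mod_cast this
        rw [he, h]
        push_cast at hC2 ⊢
        linear_combination hC2
      right
      refine ⟨t + u * (1 - t), 0 + u * (mp - 0), (hpt u u0 u1).1, (hpt u u0 u1).2, ?_, he2⟩
      by_contra hcon
      push Not at hcon
      refine P.mt.cross h3 P.ea1 a21 a2a1 d1 hd (hpt u u0 u1).1 (hpt u u0 u1).2
        (u := (0 + u * (mp - 0)) / κ) (div_nonneg g3 P.κ0.le)
        (by rw [div_le_one P.κ0]; exact hcon) ?_
      rw [he2, P.ha1]
      have : (κ : ℂ) ≠ 0 := by exact_mod_cast P.κ0.ne'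
      push_cast
      field_simp
      ring
    · linarith

end Match5

namespace Match5
open Real

/-- the unit vector at angle `t` -/
noncomputable def cis (t : ℝ) : ℂ := ⟨cos t, sin t⟩

@[simp] lemma cis_re (t : ℝ) : (cis t).re = cos t := rfl
@[simp] lemma cis_im (t : ℝ) : (cis t).im = sin t := rfl
lemma cis_zero : cis 0 = 1 := by apply Complex.ext <;> simp
lemma cis_pi : cis π = -1 := by apply Complex.ext <;> simp
lemma cis_add (a b : ℝ) : cis (a + b) = cis a * cis b := by
  apply Complex.ext
  · simp [cos_add]
  · simp [sin_add]; ring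
lemma normSq_cis (t : ℝ) : Complex.normSq (cis t) = 1 := by
  rw [Complex.normSq_apply]; simp only [cis_re, cis_im]
  nlinarith [sin_sq_add_cos_sq t]
lemma norm_cis (t : ℝ) : ‖cis t‖ = 1 := by
  have := Complex.normSq_eq_norm_sq (cis t)
  rw [normSq_cis] at this
  nlinarith [norm_nonneg (cis t)]
lemma cis_ne_zero (t : ℝ) : cis t ≠ 0 := by
  intro h; have := norm_cis t; rw [h] at this; simp at this
lemma norm_cis_sub (a b : ℝ) : ‖cis a - cis b‖ ^ 2 = 2 - 2 * cos (a - b) := by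
  rw [← Complex.normSq_eq_norm_sq, Complex.normSq_apply, cos_sub]
  simp only [Complex.sub_re, Complex.sub_im, cis_re, cis_im]
  nlinarith [sin_sq_add_cos_sq a, sin_sq_add_cos_sq b]
lemma cis_rel (u w x : ℝ) :
    (sin (u - w) : ℂ) * cis x + (sin (w - x) : ℝ) * cis u + (sin (x - u) : ℝ) * cis w = 0 := by
  apply Complex.ext
  · simp only [Complex.add_re, Complex.re_ofReal_mul, cis_re, Complex.zero_re, sin_sub]; ring
  · simp only [Complex.add_im, Complex.im_ofReal_mul, cis_im, Complex.zero_im, sin_sub]; ring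

lemma two_cos_sin (x β : ℝ) : 2 * cos (x - β / 2) * sin (β / 2) = sin x - sin (x - β) := by
  rw [sin_sub_sin, show (x - (x - β)) / 2 = β / 2 by ring,
    show (x + (x - β)) / 2 = x - β / 2 by ring]
  ring

lemma cos_half {β : ℝ} (h0 : 0 < β) (h1 : β < π / 3) : 1 / 2 < cos β := by
  rw [← cos_pi_div_three]
  exact cos_lt_cos_of_nonneg_of_le_pi h0.le (by linarith [pi_pos]) h1

lemma base_lt {β : ℝ} (h0 : 0 < β) (h1 : β < π / 3) : ‖1 - cis β‖ < 1 := by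
  have h := norm_cis_sub 0 β
  rw [cis_zero, zero_sub, cos_neg] at h
  have := cos_half h0 h1
  nlinarith [norm_nonneg (1 - cis β)]

lemma near {E : ℂ → ℂ → Prop} (hE : Mt E) {β A : ℝ} (h0 : 0 < β) (h1 : β < π / 3)
    (_ : E 0 1) (e2 : E 0 (cis β)) (e3 : E 1 (1 + cis A)) (hA : A < π) :
    A ≤ π / 2 + β / 2 := by
  by_contra hcon
  push Not at hcon
  have hb := base_lt h0 h1
  have hpos : sin β < sin (A - β) := by
    rcases le_total (A - β) (π / 2) with h | h
    · exact sin_lt_sin_of_lt_of_le_pi_div_two (by linarith) h (by linarith)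
    · rw [← sin_pi_sub (A - β)]
      exact sin_lt_sin_of_lt_of_le_pi_div_two (by linarith) (by linarith) (by linarith)
  have hβ : 0 < sin β := sin_pos_of_pos_of_lt_pi h0 (by linarith)
  have hA0 : 0 < sin A := sin_pos_of_pos_of_lt_pi (by linarith) hA
  have hAle : sin A ≤ sin (A - β) := by
    rw [← sin_pi_sub A, ← sin_pi_sub (A - β)]
    rcases le_total (π - (A - β)) (π / 2) with h | h
    · exact sin_le_sin_of_le_of_le_pi_div_two (by linarith) h (by linarith)
    · rw [← sin_pi_sub (π - (A - β))]
      exact sin_le_sin_of_le_of_le_pi_div_two (by linarith) (by linarith) (by linarith)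
  have hS : 0 < sin (A - β) := by linarith
  have hSC : ((sin (A - β) : ℝ) : ℂ) ≠ 0 := by exact_mod_cast hS.ne'
  have hrel := cis_rel A β 0
  refine hE.cross e2 e3 (t := sin A / sin (A - β)) (u := sin β / sin (A - β))
    zero_ne_one ?_ ?_ ?_ (by positivity) (by rw [div_le_one hS]; exact hAle)
    (by positivity) (by rw [div_le_one hS]; exact hpos.le) ?_
  · intro h
    have := congrArg Complex.im h
    simp at this
    linarith
  · intro h; rw [h] at hb
    have hx := hE.2.1 _ _ e2
    have : sin β = 0 := by
      have := congrArg Complex.im h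
      simpa using this
    linarith
  · intro h
    rw [h] at hb
    have : ‖(1 : ℂ) - (1 + cis A)‖ = 1 := hE.2.1 _ _ e3
    linarith
  · rw [cis_zero, sub_zero, zero_sub, sin_neg] at hrel
    push_cast at hrel hSC ⊢
    field_simp
    linear_combination -hrel

lemma trig1 {h P Q : ℝ} (h0 : 0 < h) (h1 : h < π / 6) (hP : P ≤ π / 2) (hQ : Q ≤ π / 2)
    (hPQ : 2 * h ≤ P + Q) (hs : 0 < sin (P + Q)) :
    (sin (P + Q) ≤ 2 * cos Q * sin h → |Q| ≤ h) ∧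
    (sin (P + Q) < 2 * cos Q * sin h → |Q| < h) := by
  have hpi := pi_pos
  have hsh : 0 < sin h := sin_pos_of_pos_of_lt_pi h0 (by linarith)
  have hsh2 : sin h < 1 / 2 := by
    rw [← sin_pi_div_six]
    exact sin_lt_sin_of_lt_of_le_pi_div_two (by linarith) (by linarith) h1
  have hcQ : 0 ≤ cos Q := cos_nonneg_of_mem_Icc ⟨by linarith, hQ⟩
  by_cases hc : P + Q ≤ π - 2 * h
  · have hge : 2 * sin h * cos h ≤ sin (P + Q) := by
      rw [← sin_two_mul]
      rcases le_total (P + Q) (π / 2) with h' | h'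
      · exact sin_le_sin_of_le_of_le_pi_div_two (by linarith) h' hPQ
      · rw [← sin_pi_sub (P + Q)]
        exact sin_le_sin_of_le_of_le_pi_div_two (by linarith) (by linarith) (by linarith)
    have habs : |Q| ≤ π := abs_le.2 ⟨by linarith, by linarith⟩
    constructor
    · intro hh
      have : cos h ≤ cos |Q| := by rw [cos_abs]; nlinarith
      by_contra hcon
      push Not at hcon
      have := cos_lt_cos_of_nonneg_of_le_pi h0.le habs hcon
      linarith
    · intro hh
      have : cos h < cos |Q| := by rw [cos_abs]; nlinarith
      by_contra hcon
      push Not at hcon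
      have := cos_le_cos_of_nonneg_of_le_pi h0.le habs hcon
      linarith
  · push Not at hc
    have hle : cos Q ≤ sin (P + Q) := by
      rw [← cos_pi_div_two_sub (P + Q), ← cos_neg (π / 2 - (P + Q))]
      exact cos_le_cos_of_nonneg_of_le_pi (by linarith) (by linarith) (by linarith)
    have : ¬ sin (P + Q) ≤ 2 * cos Q * sin h := by
      intro hh
      rcases hcQ.eq_or_lt with h2 | h2
      · rw [← h2] at hh; linarith
      · nlinarith
    exact ⟨fun hh => absurd hh this, fun hh => absurd hh.le this⟩

lemma inter {β A B : ℝ} (hs : sin (A + B - β) ≠ 0) :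
    (1 : ℂ) + ((2 * cos (B - β / 2) * sin (β / 2) / sin (A + B - β) : ℝ) : ℂ) * cis A =
      cis β + ((2 * cos (A - β / 2) * sin (β / 2) / sin (A + B - β) : ℝ) : ℂ) * cis (β - B) := by
  rw [two_cos_sin, two_cos_sin]
  have hC : ((sin (A + B - β) : ℝ) : ℂ) ≠ 0 := by exact_mod_cast hs
  have r1 := cis_rel A (β - B) 0
  have r2 := cis_rel A (β - B) β
  have a1 : A - (β - B) = A + B - β := by ring
  have a2 : β - B - 0 = -(B - β) := by ring
  have a3 : β - B - β = -B := by ring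
  have a4 : β - A = -(A - β) := by ring
  have a5 : (0 : ℝ) - A = -A := by ring
  rw [a1] at r1 r2
  rw [a2, a5, cis_zero] at r1
  rw [a3, a4] at r2
  rw [sin_neg, sin_neg] at r1 r2
  rw [Complex.ofReal_div, Complex.ofReal_div]
  generalize ((sin (A + B - β) : ℝ) : ℂ) = S at *
  push_cast at r1 r2 ⊢
  field_simp
  linear_combination r1 - r2

/-- data needed for the pocket analysis -/
def QA (β A B : ℝ) : Prop := ∃ s r : ℝ, 1 < s ∧ 0 < r ∧ r < 1 ∧
  (1 : ℂ) + s * cis A = cis β + r * cis (β - B) ∧ 0 < A ∧ A < 2 * π / 3 ∧ sin (A - β) < sin A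

lemma qa_of {β A B : ℝ} (h0 : 0 < β) (h1 : β < π / 3) (hA : A ≤ π / 2 + β / 2)
    (hB : B ≤ π / 2 + β / 2) (hAB : 2 * β ≤ A + B) (hs : 0 < sin (A + B - β))
    (h : sin (A + B - β) < 2 * cos (B - β / 2) * sin (β / 2)) :
    0 < B ∧ B < β ∧ QA β A B := by
  have hpi := pi_pos
  have e : A + B - β = (A - β / 2) + (B - β / 2) := by ring
  have e' : A + B - β = (B - β / 2) + (A - β / 2) := by ring
  have t1 := (trig1 (h := β / 2) (P := A - β / 2) (Q := B - β / 2) (by linarith) (by linarith)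
    (by linarith) (by linarith) (by linarith) (by rw [← e]; exact hs)).2 (by rw [← e]; exact h)
  rw [abs_lt] at t1
  have t2 := (trig1 (h := β / 2) (P := B - β / 2) (Q := A - β / 2) (by linarith) (by linarith)
    (by linarith) (by linarith) (by linarith) (by rw [← e']; exact hs)).1
  rw [← e'] at t2
  have hr : 2 * cos (A - β / 2) * sin (β / 2) < sin (A + B - β) := by
    by_contra hcon
    push Not at hcon
    have := abs_le.1 (t2 hcon)
    linarith
  have hsh : 0 < sin (β / 2) := sin_pos_of_pos_of_lt_pi (by linarith) (by linarith)
  have hsh2 : sin (β / 2) < 1 / 2 := by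
    rw [← sin_pi_div_six]
    exact sin_lt_sin_of_lt_of_le_pi_div_two (by linarith) (by linarith) (by linarith)
  have hcB : 0 < cos (B - β / 2) := cos_pos_of_mem_Ioo ⟨by linarith, by linarith⟩
  have hA2 : A - β / 2 < π / 2 := by
    rcases lt_or_eq_of_le hA with h' | h'
    · linarith
    · exfalso
      have : A + B - β = (B - β / 2) + π / 2 := by rw [h']; ring
      rw [this, sin_add_pi_div_two] at h
      nlinarith
  have hcA : 0 < cos (A - β / 2) := cos_pos_of_mem_Ioo ⟨by linarith, hA2⟩
  refine ⟨by linarith, by linarith, _, _, ?_, ?_, ?_, inter hs.ne', by linarith, by linarith, ?_⟩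
  · rw [one_lt_div hs]; exact h
  · positivity
  · rw [div_lt_one hs]; exact hr
  · have h1 : sin A = sin ((A - β / 2) + β / 2) := by ring_nf
    have h2 : sin (A - β) = sin ((A - β / 2) - β / 2) := by ring_nf
    rw [h1, h2, sin_add, sin_sub]
    nlinarith [mul_pos hcA hsh]

lemma dich {E : ℂ → ℂ → Prop} (hE : Mt E) {β A B : ℝ} (h0 : 0 < β) (h1 : β < π / 3)
    (e3 : E 1 (1 + cis A)) (e4 : E (cis β) (cis β + cis (β - B)))
    (hA : A ≤ π / 2 + β / 2) (hB : B ≤ π / 2 + β / 2) (hAB : 2 * β ≤ A + B) :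
    (A = β ∧ B = β) ∨ (0 < B ∧ B < β ∧ QA β A B) ∨ (0 < A ∧ A < β ∧ QA β B A) := by
  have hpi := pi_pos
  have hb := base_lt h0 h1
  have n3 := hE.2.1 _ _ e3
  have n4 := hE.2.1 _ _ e4
  have d1 : (1 : ℂ) ≠ cis β := by
    intro h
    have := congrArg Complex.im h
    simp at this
    have := sin_pos_of_pos_of_lt_pi h0 (by linarith)
    linarith
  have d2 : (1 : ℂ) ≠ cis β + cis (β - B) := by
    intro h; rw [← h, norm_sub_rev] at n4; linarith
  have d3 : 1 + cis A ≠ cis β := by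
    intro h; rw [h] at n3; linarith
  have hsh : 0 < sin (β / 2) := sin_pos_of_pos_of_lt_pi (by linarith) (by linarith)
  have hcA : 0 ≤ cos (A - β / 2) := cos_nonneg_of_mem_Icc ⟨by linarith, by linarith⟩
  have hcB : 0 ≤ cos (B - β / 2) := cos_nonneg_of_mem_Icc ⟨by linarith, by linarith⟩
  by_cases hpar : A + B - β = π
  · exfalso
    have hA' : A = π / 2 + β / 2 := by linarith
    have hB' : β - B = β / 2 - π / 2 := by linarith
    have hsh2 : sin (β / 2) < 1 / 2 := by
      rw [← sin_pi_div_six]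
      exact sin_lt_sin_of_lt_of_le_pi_div_two (by linarith) (by linarith) (by linarith)
    have key : cis β = 1 + ((2 * sin (β / 2) : ℝ) : ℂ) * cis A := by
      have hβ : β = 2 * (β / 2) := by ring
      rw [hA', show π / 2 + β / 2 = β / 2 + π / 2 by ring]
      apply Complex.ext
      · simp only [cis_re, Complex.add_re, Complex.one_re, Complex.re_ofReal_mul,
          cos_add_pi_div_two]
        conv_lhs => rw [hβ]
        rw [cos_two_mul, cos_sq']; ring
      · simp only [cis_im, Complex.add_im, Complex.one_im, Complex.im_ofReal_mul,
          sin_add_pi_div_two]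
        conv_lhs => rw [hβ]
        rw [sin_two_mul]; ring
    by_cases d4 : 1 + cis A = cis β + cis (β - B)
    · rw [hB', hA'] at d4
      have := congrArg Complex.im d4
      simp only [Complex.add_im, Complex.one_im, cis_im] at this
      rw [show π / 2 + β / 2 = β / 2 + π / 2 by ring, sin_add_pi_div_two,
        sin_sub_pi_div_two, show β = 2 * (β / 2) by ring, sin_two_mul] at this
      have hc : 0 < cos (β / 2) := cos_pos_of_mem_Ioo ⟨by linarith, by linarith⟩
      have e : 2 * (β / 2) / 2 = β / 2 := by ring
      rw [e] at this
      nlinarith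
    · refine hE.cross e3 e4 d1 d2 d3 d4 (t := 2 * sin (β / 2)) (u := 0) (by positivity)
        (by linarith) le_rfl zero_le_one ?_
      rw [key]; push_cast; ring
  have hs : 0 < sin (A + B - β) :=
    sin_pos_of_pos_of_lt_pi (by linarith) (lt_of_le_of_ne (by linarith) hpar)
  have hi := inter hs.ne'
  by_cases c1 : sin (A + B - β) < 2 * cos (B - β / 2) * sin (β / 2)
  · right; left
    exact qa_of h0 h1 hA hB hAB hs c1
  by_cases c2 : sin (A + B - β) < 2 * cos (A - β / 2) * sin (β / 2)
  · right; right
    have e : A + B - β = B + A - β := by ring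
    exact qa_of h0 h1 hB hA (by linarith) (by rw [← e]; exact hs) (by rw [← e]; exact c2)
  left
  push Not at c1 c2
  by_cases d4 : 1 + cis A = cis β + cis (β - B)
  · -- the rhombus
    have q1 : cis A - cis β = cis (β - B) - 1 := by linear_combination d4
    have hsum : (A - β) + (B - β) ≥ 0 := by linarith
    -- compare with the other vertex
    have f1 := congrArg Complex.re d4
    have f2 := congrArg Complex.im d4
    simp only [Complex.add_re, Complex.one_re, cis_re, Complex.add_im, Complex.one_im, cis_im]
      at f1 f2
    -- norms of the diagonal
    have g1 : sin (A + B - β) = 2 * cos (B - β / 2) * sin (β / 2) := by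
      have kB : sin B = sin β * cos (β - B) - cos β * sin (β - B) := by
        rw [← sin_sub]; ring_nf
      have kC : sin (B - β) = - sin (β - B) := by rw [← sin_neg]; ring_nf
      have kD : sin (A + B - β) = sin A * cos (β - B) - cos A * sin (β - B) := by
        rw [← sin_sub]; ring_nf
      rw [two_cos_sin, kB, kC, kD]
      linear_combination (cos (β - B)) * f2 - sin (β - B) * f1
    have g2 : sin (A + B - β) = 2 * cos (A - β / 2) * sin (β / 2) := by
      have kD : sin (A + B - β) = sin A * cos (β - B) - cos A * sin (β - B) := by
        rw [← sin_sub]; ring_nf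
      rw [two_cos_sin, kD, sin_sub A β]
      linear_combination (cos A) * f2 - sin A * f1
    have t1 := (trig1 (h := β / 2) (P := A - β / 2) (Q := B - β / 2) (by linarith) (by linarith)
      (by linarith) (by linarith) (by linarith)
      (by rw [show A - β / 2 + (B - β / 2) = A + B - β by ring]; exact hs)).1
      (by rw [show A - β / 2 + (B - β / 2) = A + B - β by ring]; exact g1.le)
    have t2 := (trig1 (h := β / 2) (P := B - β / 2) (Q := A - β / 2) (by linarith) (by linarith)
      (by linarith) (by linarith) (by linarith)
      (by rw [show B - β / 2 + (A - β / 2) = A + B - β by ring]; exact hs)).1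
      (by rw [show B - β / 2 + (A - β / 2) = A + B - β by ring]; exact g2.le)
    rw [abs_le] at t1 t2
    constructor <;> linarith
  · exfalso
    refine hE.cross e3 e4 d1 d2 d3 d4
      (t := 2 * cos (B - β / 2) * sin (β / 2) / sin (A + B - β))
      (u := 2 * cos (A - β / 2) * sin (β / 2) / sin (A + B - β))
      (by positivity) (by rw [div_le_one hs]; exact c1)
      (by positivity) (by rw [div_le_one hs]; exact c2) ?_
    linear_combination hi

lemma badA {E : ℂ → ℂ → Prop} (hE : Mt E) {β A B : ℝ} (h0 : 0 < β) (h1 : β < π / 3)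
    (e1 : E 0 1) (e2 : E 0 (cis β))
    (e3 : E 1 (1 + cis A)) (e4 : E (cis β) (cis β + cis (β - B))) (hQ : QA β A B)
    {ρ : ℝ} (hρ0 : 0 < ρ) (hρ1 : ρ < π)
    (e5 : E (1 + cis A) (1 + cis A - cis (A - ρ))) :
    ρ < π / 3 ∧ ∀ ω : ℝ, 0 < ω → ω < 2 * π →
      E (1 + cis A - cis (A - ρ)) (1 + cis A - cis (A - ρ) + cis (A - ρ - ω)) →
      ω < π / 3 ∨ 5 * π / 3 < ω := by
  have hpi := pi_pos
  obtain ⟨s, r, hs, hr0, hr1, hp, hA0, hA1, hsin⟩ := hQ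
  have hsβ : 0 < sin β := sin_pos_of_pos_of_lt_pi h0 (by linarith)
  have hsβC : ((sin β : ℝ) : ℂ) ≠ 0 := by exact_mod_cast hsβ.ne'
  have hb := base_lt h0 h1
  have hs0 : 0 < s := by linarith
  have hsC : (s : ℂ) ≠ 0 := by exact_mod_cast hs0.ne'
  have hs2 : s < 2 := by
    have e : (s : ℂ) * cis A = r * cis (β - B) - (1 - cis β) := by linear_combination hp
    have := norm_sub_le ((r : ℂ) * cis (β - B)) (1 - cis β)
    rw [← e, norm_mul, norm_mul, norm_cis, norm_cis, Complex.norm_real, Complex.norm_real,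
      Real.norm_of_nonneg hs0.le, Real.norm_of_nonneg hr0.le] at this
    linarith
  have hind : ∀ X Y : ℝ, (X : ℂ) + Y * cis β = 0 → X = 0 ∧ Y = 0 := by
    intro X Y h
    have f1 := congrArg Complex.re h
    have f2 := congrArg Complex.im h
    simp at f1 f2
    have hY : Y = 0 := by
      rcases f2 with h | h
      · exact h
      · linarith
    rw [hY] at f1
    exact ⟨by linarith, hY⟩
  have hcoord : ∀ z : ℂ, ∃ X Y : ℝ, z = X + Y * cis β := by
    intro z
    refine ⟨z.re - z.im / sin β * cos β, z.im / sin β, ?_⟩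
    apply Complex.ext
    · simp [-Complex.ofReal_div, -Complex.ofReal_mul, -Complex.ofReal_sub, -Complex.ofReal_cos,
        -Complex.ofReal_sin]
    · simp [-Complex.ofReal_div, -Complex.ofReal_mul, -Complex.ofReal_sub, -Complex.ofReal_cos,
        -Complex.ofReal_sin]
      field_simp
  have P : Pocket E (cis β) (1 + s * cis A) (1 + cis A) (cis β + cis (β - B)) (1 / s) r
      (1 + s * (sin (β - A) / sin β)) (s * (sin A / sin β)) := by
    refine ⟨hE, e1, e2, e3, e4, hb, hcoord, ?_, ?_, ?_, by positivity, ?_, ?_, hr0, hr1, ?_, ?_⟩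
    · have hrel := cis_rel A β 0
      rw [cis_zero, sub_zero, zero_sub, sin_neg,
        ← neg_sub β A, sin_neg] at hrel
      push_cast at hrel hsβC ⊢
      field_simp
      linear_combination s * hrel
    · have : 0 < s * ((sin A - sin (A - β)) / sin β) :=
        mul_pos hs0 (div_pos (by linarith) hsβ)
      have e : sin (β - A) = - sin (A - β) := by rw [← sin_neg]; ring_nf
      rw [e]
      have e' : s * ((sin A - sin (A - β)) / sin β) = s * (-sin (A - β) / sin β) +
        s * (sin A / sin β) := by ring
      linarith
    · push_cast; field_simp; ring
    · rw [div_lt_one hs0]; exact hs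
    · rw [hp]; ring
    · have : 1 + (s : ℂ) * cis A - (1 + cis A) = ((s - 1 : ℝ) : ℂ) * cis A := by
        push_cast; ring
      rw [this, norm_mul, norm_cis, Complex.norm_real, Real.norm_of_nonneg (by linarith)]
      linarith
    · have : ‖cis 0 - cis (A + π)‖ ^ 2 = 2 - 2 * cos (0 - (A + π)) := norm_cis_sub _ _
      rw [cis_zero, cis_add, cis_pi, zero_sub, cos_neg, cos_add_pi] at this
      have e : (1 : ℂ) - cis A * -1 = 1 + cis A := by ring
      rw [e] at this
      intro h
      rw [h] at this
      have h3 : cos (2 * π / 3) < cos A :=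
        cos_lt_cos_of_nonneg_of_le_pi hA0.le (by linarith) hA1
      have h4 : cos (2 * π / 3) = - (1 / 2) := by
        rw [← cos_pi_div_three, ← cos_pi_sub]; ring_nf
      linarith
  have hsρ : 0 < sin ρ := sin_pos_of_pos_of_lt_pi hρ0 hρ1
  obtain ⟨X, Y, hX, hY, hXY1, hXY, n21, n2b, a20⟩ := trap1 P hind e5 (by
    intro ma mb mp hsum hm
    have hma : (ma : ℂ) = 1 - mb - mp := by
      have : ma = 1 - mb - mp := by linarith
      rw [this]; push_cast; ring
    have key : cis A - cis (A - ρ) = mb * (cis β - 1) + (mp * s) * cis A := by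
      linear_combination hm + hma
    have f1 := congrArg Complex.re key
    have f2 := congrArg Complex.im key
    rw [← Complex.ofReal_mul] at f1 f2
    simp only [Complex.sub_re, Complex.add_re, Complex.one_re, cis_re, Complex.re_ofReal_mul,
      Complex.sub_im, Complex.add_im, Complex.one_im, cis_im, Complex.im_ofReal_mul] at f1 f2
    have g : mb * (sin A - sin (A - β)) = sin ρ := by
      have k1 : sin ρ = sin (A - (A - ρ)) := by ring_nf
      rw [k1, sin_sub A (A - ρ), sin_sub A β]
      linear_combination sin A * f1 - cos A * f2
    by_contra hcon
    push Not at hcon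
    nlinarith)
  have hρ3 : ρ < π / 3 := by
    by_contra hcon
    push Not at hcon
    have e : 1 + cis A - cis (A - ρ) - 1 = cis A - cis (A - ρ) := by ring
    have := norm_cis_sub A (A - ρ)
    rw [← e, show A - (A - ρ) = ρ by ring] at this
    have hc : cos ρ ≤ cos (π / 3) := cos_le_cos_of_nonneg_of_le_pi (by linarith) hρ1.le hcon
    rw [cos_pi_div_three] at hc
    nlinarith [norm_nonneg (1 + cis A - cis (A - ρ) - 1)]
  refine ⟨hρ3, fun ω hω0 hω1 e6 => ?_⟩
  have hfac : cis (A - ρ - ω) = cis (A - ρ) * cis (-ω) := by rw [← cis_add]; ring_nf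
  have hdne : 1 + cis A - cis (A - ρ) + cis (A - ρ - ω) ≠ 1 + cis A := by
    intro h
    have h' : cis (A - ρ) = cis (A - ρ - ω) := by linear_combination -h
    have := norm_cis_sub (A - ρ) (A - ρ - ω)
    rw [← h', sub_self, norm_zero, show A - ρ - (A - ρ - ω) = ω by ring] at this
    have hc : cos ω = 1 := by nlinarith
    have := (cos_eq_one_iff_of_lt_of_lt (by linarith) hω1).1 hc
    linarith
  rcases trap2 P hind hX hY hXY1 hXY n21 n2b a20 e6 e5 hdne with h | ⟨t, τ, t0, t1, hτ, h⟩
  · by_contra hcon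
    push Not at hcon
    have e : 1 + cis A - cis (A - ρ) + cis (A - ρ - ω) - (1 + cis A) =
      cis (A - ρ - ω) - cis (A - ρ) := by ring
    have := norm_cis_sub (A - ρ - ω) (A - ρ)
    rw [← e, show A - ρ - ω - (A - ρ) = -ω by ring, cos_neg] at this
    have hc : cos ω ≤ cos (π / 3) := by
      rcases le_total ω π with h | h
      · exact cos_le_cos_of_nonneg_of_le_pi (by linarith) h hcon.1
      · rw [← cos_two_pi_sub ω]
        exact cos_le_cos_of_nonneg_of_le_pi (by linarith) (by linarith) (by linarith)
    rw [cos_pi_div_three] at hc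
    nlinarith [norm_nonneg (1 + cis A - cis (A - ρ) + cis (A - ρ - ω) - (1 + cis A))]
  · right
    by_contra hcon
    push Not at hcon
    have hk : 0 < τ * s - 1 := by
      rw [div_lt_iff₀ hs0] at hτ; linarith
    have hA' : cis A = cis (A - ρ) * cis ρ := by rw [← cis_add]; ring_nf
    have hne := cis_ne_zero (A - ρ)
    have key : (t : ℂ) * cis (-ω) = 1 + ((τ * s - 1 : ℝ) : ℂ) * cis ρ := by
      rw [hfac] at h
      apply mul_left_cancel₀ hne
      push_cast
      linear_combination h + (τ * s - 1) * hA'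
    have f1 := congrArg Complex.re key
    have f2 := congrArg Complex.im key
    simp only [Complex.add_re, Complex.one_re, cis_re, Complex.re_ofReal_mul,
      Complex.add_im, Complex.one_im, cis_im, Complex.im_ofReal_mul, cos_neg, sin_neg] at f1 f2
    have hsω : sin ω < 0 := by
      by_contra hc
      push Not at hc
      nlinarith [mul_pos hk hsρ]
    have hωπ : π < ω := by
      by_contra hc
      push Not at hc
      linarith [sin_nonneg_of_nonneg_of_le_pi hω0.le hc]
    have h3 : sin (ω + π / 3) ≤ 0 := by
      have := sin_nonneg_of_nonneg_of_le_pi (x := 2 * π - (ω + π / 3)) (by linarith) (by linarith)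
      rw [sin_two_pi_sub] at this
      linarith
    have h4 : t * sin (ω + π / 3) = sin (π / 3) + (τ * s - 1) * sin (π / 3 - ρ) := by
      rw [sin_add, sin_sub]
      linear_combination sin (π / 3) * f1 - cos (π / 3) * f2
    have h5 : 0 < sin (π / 3) := sin_pos_of_pos_of_lt_pi (by linarith) (by linarith)
    have h6 : 0 < sin (π / 3 - ρ) := sin_pos_of_pos_of_lt_pi (by linarith) (by linarith)
    nlinarith [mul_pos hk h6]

end Match5

namespace Match5
open Real

lemma Mt.comap {E : ℂ → ℂ → Prop} (hE : Mt E) (f : ℂ → ℂ) (hn : ∀ p q, ‖f p - f q‖ = ‖p - q‖)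
    (hf : ∀ (p q : ℂ) (a b : ℝ), a + b = 1 → f (a * p + b * q) = a * f p + b * f q) :
    Mt (fun p q => E (f p) (f q)) := by
  have hinj : ∀ p q, p ≠ q → f p ≠ f q := by
    intro p q h h'
    have := hn p q
    rw [h', sub_self, norm_zero] at this
    exact h (sub_eq_zero.1 (norm_eq_zero.1 this.symm))
  refine ⟨fun p q h => hE.1 _ _ h, fun p q h => by rw [← hn]; exact hE.2.1 _ _ h, ?_⟩
  intro p q r s h1 h2 a1 a2 a3 a4 z hz1 hz2
  have hseg : ∀ p q, z ∈ segment ℝ p q → f z ∈ segment ℝ (f p) (f q) := by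
    rintro p q ⟨a, b, ha, hb, hab, rfl⟩
    refine ⟨a, b, ha, hb, hab, ?_⟩
    rw [Complex.real_smul, Complex.real_smul, Complex.real_smul, Complex.real_smul, hf _ _ _ _ hab]
  exact hE.2.2 _ _ _ _ h1 h2 (hinj _ _ a1) (hinj _ _ a2) (hinj _ _ a3) (hinj _ _ a4) (f z)
    (hseg _ _ hz1) (hseg _ _ hz2)

lemma Mt.affine {E : ℂ → ℂ → Prop} (hE : Mt E) (v w : ℂ) (hw : ‖w‖ = 1) :
    Mt (fun p q => E (v + w * p) (v + w * q)) := by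
  apply hE.comap (fun p => v + w * p)
  · intro p q
    rw [show v + w * p - (v + w * q) = w * (p - q) by ring, norm_mul, hw, one_mul]
  · intro p q a b hab
    have : (a : ℂ) + b = 1 := by exact_mod_cast hab
    linear_combination (-v) * this

open ComplexConjugate in
lemma Mt.mirror {E : ℂ → ℂ → Prop} (hE : Mt E) (β : ℝ) :
    Mt (fun p q => E (cis β * conj p) (cis β * conj q)) := by
  apply hE.comap (fun p => cis β * conj p)
  · intro p q
    rw [show cis β * conj p - cis β * conj q = cis β * conj (p - q) by rw [map_sub]; ring,
      norm_mul, norm_cis, one_mul, Complex.norm_conj]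
  · intro p q a b hab
    simp only [map_add, map_mul, Complex.conj_ofReal]
    ring

open ComplexConjugate in
lemma cis_conj (t : ℝ) : conj (cis t) = cis (-t) := by
  apply Complex.ext <;> simp

open ComplexConjugate in
lemma local_norm {E : ℂ → ℂ → Prop} (hE : Mt E) {β A B : ℝ} (h0 : 0 < β) (h1 : β < π / 3)
    (e1 : E 0 1) (e2 : E 0 (cis β))
    (e3 : E 1 (1 + cis A)) (e4 : E (cis β) (cis β + cis (β - B))) (hA : A < π) (hB : B < π) :
    A ≤ π / 2 + β / 2 ∧ B ≤ π / 2 + β / 2 ∧ (A + B < 2 * β ∨ (A = β ∧ B = β) ∨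
      (B < β ∧ ∀ ρ, 0 < ρ → ρ < π → E (1 + cis A) (1 + cis A - cis (A - ρ)) →
        ρ < π / 3 ∧ ∀ ω : ℝ, 0 < ω → ω < 2 * π →
        E (1 + cis A - cis (A - ρ)) (1 + cis A - cis (A - ρ) + cis (A - ρ - ω)) →
        ω < π / 3 ∨ 5 * π / 3 < ω) ∨
      (A < β ∧ ∀ ρ, 0 < ρ → ρ < π →
        E (cis β + cis (β - B)) (cis β + cis (β - B) - cis (β - B + ρ)) →
        ρ < π / 3 ∧ ∀ ω : ℝ, 0 < ω → ω < 2 * π →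
        E (cis β + cis (β - B) - cis (β - B + ρ))
          (cis β + cis (β - B) - cis (β - B + ρ) + cis (β - B + ρ + ω)) →
        ω < π / 3 ∨ 5 * π / 3 < ω)) := by
  have hM := hE.mirror β
  have q0 : cis β * conj (0 : ℂ) = 0 := by simp
  have q1 : cis β * conj (1 : ℂ) = cis β := by simp
  have q2 : cis β * conj (cis β) = 1 := by
    rw [cis_conj, ← cis_add, add_neg_cancel, cis_zero]
  have q3 : ∀ t, cis β * conj (cis t) = cis (β - t) := by
    intro t; rw [cis_conj, ← cis_add, sub_eq_add_neg]
  have q4 : ∀ t, cis β * conj (1 + cis t) = cis β + cis (β - t) := by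
    intro t; rw [map_add, mul_add, q1, q3]
  have e1' : E (cis β * conj 0) (cis β * conj 1) := by rw [q0, q1]; exact e2
  have e2' : E (cis β * conj 0) (cis β * conj (cis β)) := by rw [q0, q2]; exact e1
  have e3' : E (cis β * conj 1) (cis β * conj (1 + cis B)) := by rw [q1, q4]; exact e4
  have e4' : E (cis β * conj (cis β)) (cis β * conj (cis β + cis (β - A))) := by
    rw [map_add, mul_add, q2, q3, sub_sub_cancel]; exact e3
  have nA := near hE h0 h1 e1 e2 e3 hA
  have nB := near hM h0 h1 e1' e2' e3' hB
  refine ⟨nA, nB, ?_⟩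
  by_cases hs : A + B < 2 * β
  · exact Or.inl hs
  push Not at hs
  rcases dich hE h0 h1 e3 e4 nA nB hs with h | ⟨-, h, hq⟩ | ⟨-, h, hq⟩
  · exact Or.inr (Or.inl h)
  · right; right; left
    exact ⟨h, fun ρ r0 r1 e5 => badA hE h0 h1 e1 e2 e3 e4 hq r0 r1 e5⟩
  · right; right; right
    refine ⟨h, fun ρ r0 r1 e5 => ?_⟩
    have q5 : cis β * conj (1 + cis B - cis (B - ρ)) =
        cis β + cis (β - B) - cis (β - B + ρ) := by
      rw [map_sub, mul_sub, q4, q3, show β - (B - ρ) = β - B + ρ by ring]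
    have q6 : ∀ ω, cis β * conj (1 + cis B - cis (B - ρ) + cis (B - ρ - ω)) =
        cis β + cis (β - B) - cis (β - B + ρ) + cis (β - B + ρ + ω) := by
      intro ω
      rw [map_add, mul_add, q5, q3, show β - (B - ρ - ω) = β - B + ρ + ω by ring]
    obtain ⟨k1, k2⟩ := badA hM h0 h1 e1' e2' e3' e4' hq r0 r1 (by
      show E (cis β * conj (1 + cis B)) (cis β * conj (1 + cis B - cis (B - ρ)))
      rw [q4, q5]; exact e5)
    refine ⟨k1, fun ω w0 w1 e6 => k2 ω w0 w1 ?_⟩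
    show E (cis β * conj (1 + cis B - cis (B - ρ)))
      (cis β * conj (1 + cis B - cis (B - ρ) + cis (B - ρ - ω)))
    rw [q5, q6]; exact e6

lemma corner_local {X : Type*} {E : ℂ → ℂ → Prop} (hE : Mt E) (φ : Equiv.Perm X) (α : X → ℝ) (P : X → ℂ)
    (hα : ∀ x, 0 < α x) (hα2 : ∀ x, α x < 2 * π) (edge : ∀ x, E (P x) (P (φ x)))
    (hP : ∀ x, P (φ x) - P x = cis (α x) * (P (φ.symm x) - P x))
    (x : X) (hx : α x < π / 3) :
    (π / 3 ≤ α (φ x) ∧ π / 3 ≤ α (φ.symm x)) ∧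
    (2 * π - 2 * α x < α (φ x) + α (φ.symm x) ∨
      (α (φ x) = π - α x ∧ α (φ.symm x) = π - α x) ∨
      (π - α x < α (φ x) ∧ (α (φ.symm (φ.symm x)) < π → α (φ.symm (φ.symm x)) < π / 3 ∧
        (α (φ.symm (φ.symm (φ.symm x))) < π / 3 ∨
          5 * π / 3 < α (φ.symm (φ.symm (φ.symm x)))))) ∨
      (π - α x < α (φ.symm x) ∧ (α (φ (φ x)) < π → α (φ (φ x)) < π / 3 ∧
        (α (φ (φ (φ x))) < π / 3 ∨ 5 * π / 3 < α (φ (φ (φ x))))))) := by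
  have edge' : ∀ x, E (P x) (P (φ.symm x)) := by
    intro x
    have := edge (φ.symm x)
    rw [Equiv.apply_symm_apply] at this
    exact hE.1 _ _ this
  have cinv : ∀ t, cis t * cis (-t) = 1 := by
    intro t; rw [← cis_add, add_neg_cancel, cis_zero]
  have hP' : ∀ x, P (φ.symm (φ.symm x)) - P (φ.symm x) =
      cis (-α (φ.symm x)) * (P x - P (φ.symm x)) := by
    intro x
    have := hP (φ.symm x)
    rw [Equiv.apply_symm_apply] at this
    rw [this]
    linear_combination -(P (φ.symm (φ.symm x)) - P (φ.symm x)) * cinv (α (φ.symm x))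
  have hQ : ∀ x, P (φ (φ x)) - P (φ x) = cis (α (φ x)) * (P x - P (φ x)) := by
    intro x
    have := hP (φ x)
    rwa [Equiv.symm_apply_apply] at this
  set β := α x with hβ
  set A := π - α (φ.symm x) with hA
  set B := π - α (φ x) with hB
  set w := P (φ.symm x) - P x with hw
  have hw1 : ‖w‖ = 1 := by
    rw [hw, norm_sub_rev]; exact hE.2.1 _ _ (edge' x)
  have cA : cis A = - cis (-α (φ.symm x)) := by
    rw [hA, sub_eq_add_neg, cis_add, cis_pi]; ring
  have cB : cis (β - B) = - (cis β * cis (α (φ x))) := by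
    rw [show β - B = β + α (φ x) + -π by rw [hB]; ring, cis_add, cis_add]
    have : cis (-π) = -1 := by
      have := cinv π
      rw [cis_pi] at this
      linear_combination -this
    rw [this]; ring
  have p1 : P (φ.symm x) = P x + w * 1 := by rw [hw]; ring
  have p2 : P (φ x) = P x + w * cis β := by linear_combination hP x
  have p0 : P x = P x + w * 0 := by ring
  have p3 : P (φ.symm (φ.symm x)) = P x + w * (1 + cis A) := by
    have := hP' x
    rw [cA]
    linear_combination this + p1 - cis (-α (φ.symm x)) * p1
  have p4 : P (φ (φ x)) = P x + w * (cis β + cis (β - B)) := by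
    have := hQ x
    rw [cB]
    linear_combination this + p2 - cis (α (φ x)) * p2
  have p5 : P (φ.symm (φ.symm (φ.symm x))) =
      P x + w * (1 + cis A - cis (A - α (φ.symm (φ.symm x)))) := by
    have := hP' (φ.symm x)
    rw [sub_eq_add_neg A, cis_add]
    linear_combination this + p3 - cis (-α (φ.symm (φ.symm x))) * (p3 - p1)
  have p6 : P (φ (φ (φ x))) = P x + w * (cis β + cis (β - B) - cis (β - B + α (φ (φ x)))) := by
    have := hQ (φ x)
    rw [cis_add (β - B)]
    linear_combination this + p4 - cis (α (φ (φ x))) * (p4 - p2)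
  have p7 : P (φ.symm (φ.symm (φ.symm (φ.symm x)))) =
      P x + w * (1 + cis A - cis (A - α (φ.symm (φ.symm x))) +
        cis (A - α (φ.symm (φ.symm x)) - α (φ.symm (φ.symm (φ.symm x))))) := by
    have := hP' (φ.symm (φ.symm x))
    rw [sub_eq_add_neg (A - _), cis_add]
    linear_combination this + p5 - cis (-α (φ.symm (φ.symm (φ.symm x)))) * (p5 - p3)
  have p8 : P (φ (φ (φ (φ x)))) = P x + w * (cis β + cis (β - B) - cis (β - B + α (φ (φ x))) +
      cis (β - B + α (φ (φ x)) + α (φ (φ (φ x))))) := by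
    have := hQ (φ (φ x))
    rw [cis_add (β - B + _)]
    linear_combination this + p6 - cis (α (φ (φ (φ x)))) * (p6 - p4)
  have hx0 := hα x
  have hx1 := hα (φ x)
  have hx2 := hα (φ.symm x)
  obtain ⟨nA, nB, hh⟩ := local_norm (hE.affine (P x) w hw1) (β := β) (A := A) (B := B) hx0 hx
    (by rw [← p0, ← p1]; exact edge' x) (by rw [← p0, ← p2]; exact edge x)
    (by rw [← p1, ← p3]; exact edge' _) (by rw [← p2, ← p4]; exact edge _)
    (by rw [hA]; linarith) (by rw [hB]; linarith)
  refine ⟨⟨by rw [hB] at nB; linarith, by rw [hA] at nA; linarith⟩, ?_⟩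
  rcases hh with h | ⟨h, h'⟩ | ⟨h, h'⟩ | ⟨h, h'⟩
  · left; rw [hA, hB] at h; linarith
  · right; left; rw [hA] at h; rw [hB] at h'; constructor <;> linarith
  · right; right; left
    refine ⟨by rw [hB] at h; linarith, fun hlt => ?_⟩
    obtain ⟨k1, k2⟩ := h' _ (hα _) hlt (by rw [← p3, ← p5]; exact edge' _)
    exact ⟨k1, k2 _ (hα _) (hα2 _) (by rw [← p5, ← p7]; exact edge' _)⟩
  · right; right; right
    refine ⟨by rw [hA] at h; linarith, fun hlt => ?_⟩
    obtain ⟨k1, k2⟩ := h' _ (hα _) hlt (by rw [← p4, ← p6]; exact edge _)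
    exact ⟨k1, k2 _ (hα _) (hα2 _) (by rw [← p6, ← p8]; exact edge _)⟩

lemma corner_adj {X : Type*} {E : ℂ → ℂ → Prop} (hE : Mt E) (φ : Equiv.Perm X) (α : X → ℝ) (P : X → ℂ)
    (hα : ∀ x, 0 < α x) (hα2 : ∀ x, α x < 2 * π) (edge : ∀ x, E (P x) (P (φ x)))
    (hP : ∀ x, P (φ x) - P x = cis (α x) * (P (φ.symm x) - P x))
    (x : X) (hx : α x < π / 3) : π / 3 ≤ α (φ x) ∧ π / 3 ≤ α (φ.symm x) :=
  (corner_local hE φ α P hα hα2 edge hP x hx).1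

lemma corner_main {X : Type*} {E : ℂ → ℂ → Prop} (hE : Mt E) (φ : Equiv.Perm X) (α : X → ℝ) (P : X → ℂ)
    (hα : ∀ x, 0 < α x) (hα2 : ∀ x, α x < 2 * π) (edge : ∀ x, E (P x) (P (φ x)))
    (hP : ∀ x, P (φ x) - P x = cis (α x) * (P (φ.symm x) - P x))
    (x : X) (hx : α x < π / 3) :
    2 * π - 2 * α x < α (φ x) + α (φ.symm x) ∨
      (α (φ x) = π - α x ∧ α (φ.symm x) = π - α x) ∨
      (π - α x < α (φ x) ∧ (π ≤ α (φ.symm (φ.symm x)) ∨ (α (φ.symm (φ.symm x)) < π / 3 ∧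
          5 * π / 3 < α (φ.symm (φ.symm (φ.symm x)))))) ∨
      (π - α x < α (φ.symm x) ∧ (π ≤ α (φ (φ x)) ∨ (α (φ (φ x)) < π / 3 ∧
        5 * π / 3 < α (φ (φ (φ x)))))) := by
  rcases (corner_local hE φ α P hα hα2 edge hP x hx).2 with h | h | ⟨h, h'⟩ | ⟨h, h'⟩
  · exact Or.inl h
  · exact Or.inr (Or.inl h)
  · right; right; left
    refine ⟨h, ?_⟩
    rcases le_or_gt π (α (φ.symm (φ.symm x))) with c | c
    · exact Or.inl c
    · obtain ⟨k1, k2⟩ := h' c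
      have := (corner_adj hE φ α P hα hα2 edge hP _ k1).2
      rcases k2 with k2 | k2
      · linarith
      · exact Or.inr ⟨k1, k2⟩
  · right; right; right
    refine ⟨h, ?_⟩
    rcases le_or_gt π (α (φ (φ x))) with c | c
    · exact Or.inl c
    · obtain ⟨k1, k2⟩ := h' c
      have := (corner_adj hE φ α P hα hα2 edge hP _ k1).1
      rcases k2 with k2 | k2
      · linarith
      · exact Or.inr ⟨k1, k2⟩

end Match5

namespace Match5
open Real

lemma cis_inj {s t : ℝ} (hs0 : 0 < s) (hs1 : s ≤ 2 * π) (ht0 : 0 < t) (ht1 : t ≤ 2 * π)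
    (h : cis s = cis t) : s = t := by
  have := norm_cis_sub s t
  rw [h, sub_self, norm_zero] at this
  have hc : cos (s - t) = 1 := by nlinarith
  have := (cos_eq_one_iff_of_lt_of_lt (by linarith) (by linarith)).1 hc
  linarith

lemma cis_two_pi : cis (2 * π) = 1 := by
  apply Complex.ext <;> simp

lemma cis_arg {w : ℂ} (hw : ‖w‖ = 1) : cis w.arg = w := by
  apply Complex.ext
  · have := Complex.norm_mul_cos_arg w
    rw [hw, one_mul] at this
    exact this
  · have := Complex.norm_mul_sin_arg w
    rw [hw, one_mul] at this
    exact this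

lemma exists_cis {w : ℂ} (hw : ‖w‖ = 1) : ∃ t : ℝ, 0 < t ∧ t ≤ 2 * π ∧ w = cis t := by
  have hpi := pi_pos
  have h1 := Complex.neg_pi_lt_arg w
  have h2 := Complex.arg_le_pi w
  rcases lt_or_ge 0 w.arg with h | h
  · exact ⟨w.arg, h, by linarith, (cis_arg hw).symm⟩
  · refine ⟨w.arg + 2 * π, by linarith, by linarith, ?_⟩
    rw [cis_add, cis_two_pi, mul_one, cis_arg hw]

lemma rot {N : Type*} [Fintype N] [Nontrivial N] (u : N → ℂ) (hu : ∀ a, ‖u a‖ = 1)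
    (hinj : Function.Injective u) :
    ∃ (σ : N → N) (α : N → ℝ), Function.Injective σ ∧
      (∀ a, 0 < α a ∧ α a < 2 * π ∧ u (σ a) = cis (α a) * u a) ∧ ∑ a, α a ≤ 2 * π := by
  classical
  have hpi := pi_pos
  have hu0 : ∀ a, u a ≠ 0 := by
    intro a h; have := hu a; rw [h, norm_zero] at this; exact zero_ne_one this
  have hex : ∀ a b, ∃ t : ℝ, 0 < t ∧ t ≤ 2 * π ∧ u b = cis t * u a := by
    intro a b
    obtain ⟨t, h0, h1, h2⟩ := exists_cis (w := u b / u a) (by rw [norm_div, hu, hu, div_one])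
    refine ⟨t, h0, h1, ?_⟩
    rw [← h2, div_mul_cancel₀ _ (hu0 a)]
  choose τ τ0 τ1 hτ using hex
  have huniq : ∀ a b t, 0 < t → t ≤ 2 * π → u b = cis t * u a → τ a b = t := by
    intro a b t h0 h1 h
    apply cis_inj (τ0 _ _) (τ1 _ _) h0 h1
    apply mul_right_cancel₀ (hu0 a)
    rw [← hτ, ← h]
  have hlt : ∀ a b, a ≠ b → τ a b < 2 * π := by
    intro a b hab
    refine lt_of_le_of_ne (τ1 a b) fun h => hab ?_
    have := hτ a b
    rw [h, cis_two_pi, one_mul] at this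
    exact (hinj this).symm
  have hmin : ∀ a, ∃ b, ∀ c, τ a b ≤ τ a c := by
    intro a
    obtain ⟨b, -, hb⟩ := Finset.exists_min_image Finset.univ (τ a) ⟨a, Finset.mem_univ a⟩
    exact ⟨b, fun c => hb c (Finset.mem_univ c)⟩
  choose σ hσ using hmin
  have hσinj : Function.Injective σ := by
    have key : ∀ a a', σ a = σ a' → ¬ τ a (σ a) < τ a' (σ a') := by
      intro a a' h hl
      have h1 := hτ a (σ a)
      have h2 := hτ a' (σ a')
      have h3 := τ0 a (σ a)
      rw [← h] at h2 hl
      have : τ a' a = τ a' (σ a) - τ a (σ a) := by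
        apply huniq _ _ _ (by linarith) (by linarith [τ1 a' (σ a)])
        apply mul_left_cancel₀ (cis_ne_zero (τ a (σ a)))
        rw [← mul_assoc, ← cis_add, ← h1, h2]
        ring_nf
      have h4 := hσ a' a
      rw [← h] at h4
      linarith
    intro a a' h
    have e : τ a (σ a) = τ a' (σ a') :=
      le_antisymm (not_lt.1 (key a' a h.symm)) (not_lt.1 (key a a' h))
    apply hinj
    apply mul_left_cancel₀ (cis_ne_zero (τ a (σ a)))
    rw [← hτ, e, ← hτ, h]
  refine ⟨σ, fun a => τ a (σ a), hσinj, fun a => ⟨τ0 _ _, ?_, hτ _ _⟩, ?_⟩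
  · obtain ⟨b, hb⟩ := exists_ne a
    exact (hσ a b).trans_lt (hlt a b hb.symm)
  · obtain ⟨a0⟩ : Nonempty N := inferInstance
    have h00 : τ a0 a0 = 2 * π := by
      apply huniq _ _ _ (by linarith) le_rfl
      rw [cis_two_pi, one_mul]
    have hle : ∀ a, τ a (σ a) ≤ τ a0 (σ a) - τ a0 a + if a = a0 then 2 * π else 0 := by
      intro a
      split_ifs with h
      · rw [h, h00]; linarith
      · rw [add_zero]
        have hl := hlt a0 a (Ne.symm h)
        have hp := τ0 a0 a
        have h1 : τ a a0 = 2 * π - τ a0 a := by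
          apply huniq _ _ _ (by linarith) (by linarith)
          rw [hτ a0 a, ← mul_assoc, ← cis_add, sub_add_cancel, cis_two_pi, one_mul]
        have h2 := hσ a a0
        rw [h1] at h2
        have h3 : τ a0 (σ a) = τ a (σ a) + τ a0 a := by
          apply huniq _ _ _ (by linarith [τ0 a (σ a)]) (by linarith)
          rw [cis_add, mul_assoc, ← hτ, ← hτ]
        linarith
    have hbij : Function.Bijective σ := Finite.injective_iff_bijective.1 hσinj
    calc ∑ a, τ a (σ a) ≤ ∑ a, (τ a0 (σ a) - τ a0 a + if a = a0 then 2 * π else 0) :=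
          Finset.sum_le_sum fun a _ => hle a
      _ = 2 * π := by
          rw [Finset.sum_add_distrib, Finset.sum_sub_distrib,
            Function.Bijective.sum_comp hbij (fun b => τ a0 b)]
          simp

lemma reflex {N : Type*} [Fintype N] [Nonempty N] (u : N → ℂ) (hu : ∀ a, ‖u a‖ = 1)
    (hre : ∀ a, (u a).re ≤ 0) (σ : N → N) (α : N → ℝ)
    (h : ∀ a, 0 < α a ∧ α a < 2 * π ∧ u (σ a) = cis (α a) * u a) : ∃ a, π ≤ α a := by
  have hpi := pi_pos
  obtain ⟨a, -, ha⟩ := Finset.exists_max_image Finset.univ (fun a => (-u a).arg)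
    Finset.univ_nonempty
  refine ⟨a, ?_⟩
  obtain ⟨h0, h1, h2⟩ := h a
  have hb := ha (σ a) (Finset.mem_univ _)
  have hr : ∀ b, |(-u b).arg| ≤ π / 2 := by
    intro b
    rw [Complex.abs_arg_le_pi_div_two_iff, Complex.neg_re]
    linarith [hre b]
  have r1 := abs_le.1 (hr a)
  have r2 := abs_le.1 (hr (σ a))
  have c : ∀ b, u b = - cis ((-u b).arg) := by
    intro b; rw [cis_arg (by rw [norm_neg, hu]), neg_neg]
  set s := (-u a).arg with hs
  set s' := (-u (σ a)).arg with hs'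
  have e : cis (α a) = cis (s' - s + 2 * π) := by
    apply mul_right_cancel₀ (cis_ne_zero s)
    rw [← cis_add (_ + _), show s' - s + 2 * π + s = s' + 2 * π by ring, cis_add, cis_two_pi, mul_one]
    rw [c a, c (σ a)] at h2
    linear_combination h2
  have := cis_inj h0 h1.le (by linarith) (by linarith) e
  linarith

lemma main {V : Type*} [Fintype V] [Nonempty V] (G : SimpleGraph V) (z : V → ℂ)
    (hz : Function.Injective z) (hdeg : ∀ v, 5 ≤ (G.neighborSet v).ncard)
    (hE : Mt (fun p q => ∃ a b, G.Adj a b ∧ z a = p ∧ z b = q)) : False := by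
  classical
  have hpi := pi_pos
  have hcard : ∀ v, 5 ≤ Fintype.card {a // G.Adj v a} := by
    intro v
    have := hdeg v
    rw [Set.ncard_eq_toFinset_card', Set.toFinset_card] at this
    exact this
  have hnt : ∀ v, Nontrivial {a // G.Adj v a} := by
    intro v
    rw [← Fintype.one_lt_card_iff_nontrivial]
    linarith [hcard v]
  have hunit : ∀ v (a : {a // G.Adj v a}), ‖z a.1 - z v‖ = 1 := by
    intro v a
    exact hE.2.1 _ _ ⟨a.1, v, a.2.symm, rfl, rfl⟩
  have hrot := fun v => rot (fun a : {a // G.Adj v a} => z a.1 - z v) (hunit v)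
    (fun a b h => Subtype.ext (hz (sub_left_injective h)))
  choose σ α hσ hα hsum using hrot
  let X := Σ v : V, {a // G.Adj v a}
  have hext : ∀ x y : X, x.1 = y.1 → x.2.1 = y.2.1 → x = y := by
    rintro ⟨v, a, ha⟩ ⟨w, b, hb⟩ h1 h2
    simp only at h1 h2
    subst h1; subst h2; rfl
  let f : X → X := fun x => ⟨(σ x.1 x.2).1, ⟨x.1, (σ x.1 x.2).2.symm⟩⟩
  have hf : Function.Injective f := by
    rintro ⟨v, a⟩ ⟨w, b⟩ h
    have h2 : v = w := congrArg (fun x : X => x.2.1) h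
    subst h2
    have h1 : (σ v a).1 = (σ v b).1 := congrArg (fun x : X => x.1) h
    rw [hσ v (Subtype.ext h1)]
  let φ : Equiv.Perm X := Equiv.ofBijective f (Finite.injective_iff_bijective.1 hf)
  let β : X → ℝ := fun x => α x.1 x.2
  let P : X → ℂ := fun x => z x.1
  have hφ1 : ∀ x, P (φ x) = z (σ x.1 x.2).1 := fun x => rfl
  have hφ2 : ∀ x, P (φ.symm x) = z x.2.1 := by
    intro x
    obtain ⟨y, rfl⟩ := φ.surjective x
    rw [Equiv.symm_apply_apply]
    rfl
  have hβ0 : ∀ x, 0 < β x := fun x => (hα x.1 x.2).1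
  have hβ1 : ∀ x, β x < 2 * π := fun x => (hα x.1 x.2).2.1
  have hedge : ∀ x, ∃ a b, G.Adj a b ∧ z a = P x ∧ z b = P (φ x) :=
    fun x => ⟨_, _, (σ x.1 x.2).2, rfl, rfl⟩
  have hP : ∀ x, P (φ x) - P x = cis (β x) * (P (φ.symm x) - P x) := by
    intro x
    rw [hφ1, hφ2]
    exact (hα x.1 x.2).2.2
  obtain ⟨v, -, hv⟩ := Finset.exists_max_image Finset.univ (fun v => (z v).re)
    Finset.univ_nonempty
  obtain ⟨a, ha⟩ := reflex (fun a : {a // G.Adj v a} => z a.1 - z v) (hunit v)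
    (fun a => by
      rw [Complex.sub_re]
      linarith [hv a.1 (Finset.mem_univ _)]) (σ v) (α v) (hα v)
  have hneg := discharge φ β hβ0 (corner_adj hE φ β P hβ0 hβ1 hedge hP)
    (corner_main hE φ β P hβ0 hβ1 hedge hP) ⟨v, a⟩ ha
  have hpos : 0 ≤ ∑ x, (dem (β x) - 2 * off (β x)) := by
    rw [Fintype.sum_sigma]
    exact Finset.sum_nonneg fun w _ => vertex_ineq Finset.univ (α w)
      (by rw [Finset.card_univ]; exact hcard w) (hsum w)
  linarith

end Match5

/-- No finite matchstick graph with minimum degree at least `5` exists. -/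
theorem no_finite_min_degree_five_matchstick_graph :
    ¬ ∃ (V : Type) (_ : Fintype V) (_ : Nonempty V) (G : SimpleGraph V)
        (g : V → EuclideanSpace ℝ (Fin 2)),
      (∀ v : V, 5 ≤ (G.neighborSet v).ncard) ∧ IsMatchstickEmbedding G g := by
  rintro ⟨V, _, _, G, g, hdeg, hinj, hdist, hcross⟩
  let L := Complex.orthonormalBasisOneI.repr
  have hLz : ∀ v, L (L.symm (g v)) = g v := fun v => L.apply_symm_apply _
  refine Match5.main G (fun v => L.symm (g v)) (L.symm.injective.comp hinj) hdeg ⟨?_, ?_, ?_⟩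
  · rintro p q ⟨a, b, h, rfl, rfl⟩
    exact ⟨b, a, h.symm, rfl, rfl⟩
  · rintro p q ⟨a, b, h, rfl, rfl⟩
    rw [← map_sub, LinearIsometryEquiv.norm_map, ← dist_eq_norm]
    exact hdist a b h
  · rintro p q r s ⟨a, b, h, rfl, rfl⟩ ⟨c, d, h', rfl, rfl⟩ n1 n2 n3 n4 z hz1 hz2
    have hseg : ∀ a b, z ∈ segment ℝ (L.symm (g a)) (L.symm (g b)) →
        L z ∈ segment ℝ (g a) (g b) := by
      rintro a b ⟨s, t, hs, ht, hst, rfl⟩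
      refine ⟨s, t, hs, ht, hst, ?_⟩
      rw [map_add, map_smul, map_smul, hLz, hLz]
    have hemp : ({a, b} : Set V) ∩ ({c, d} : Set V) = ∅ := by
      rw [Set.eq_empty_iff_forall_notMem]
      rintro x ⟨hx1, hx2⟩
      simp only [Set.mem_insert_iff, Set.mem_singleton_iff] at hx1 hx2
      rcases hx1 with rfl | rfl <;> rcases hx2 with rfl | rfl
      · exact n1 rfl
      · exact n2 rfl
      · exact n3 rfl
      · exact n4 rfl
    have := hcross a b c d h h' hemp
    rw [Set.eq_empty_iff_forall_notMem] at this
    exact this (L z) ⟨hseg _ _ hz1, hseg _ _ hz2⟩
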